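/- Let 0 < α ≤ 2 and 2 < p, r < ∞ satisfy (1/α)(1 − 2/p) ≤ 1/r < (1/α + 1/4)(1 − 2/p). Then there exists C = C(α, p, r) > 0 such that for all A ∈ ℝ \ {0}, κ > 0, 1 ≤ q ≤ ∞, s ∈ ℝ and f ∈ Ḃ^s_{2,q}(ℝ²): ‖T_A(·) f‖_{L̃^r(0,∞; Ḃ^s_{p,q})} ≤ C κ^{−(1/α)(1 − 2/p)} |A|^{(1/α)(1 − 2/p) − 1/r} ‖f‖_{Ḃ^s_{2,q}}. -/

import Mathlib

open MeasureTheory Complex Filter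
open scoped FourierTransform ENNReal NNReal Topology

noncomputable section

/-- The plane `ℝ²`. -/
abbrev Plane := EuclideanSpace ℝ (Fin 2)

/-- Fourier multiplier operator with symbol `m`. -/
def fourierMult (m : Plane → ℂ) (f : Plane → ℂ) : Plane → ℂ :=
  𝓕⁻ (fun ξ => m ξ * 𝓕 f ξ)

/-- The Riesz transform `R_k`, `k = 0, 1` (corresponding to `R₁, R₂`). -/
def riesz (k : Fin 2) (f : Plane → ℂ) : Plane → ℂ :=
  fourierMult (fun ξ => Complex.I * (ξ k : ℝ) / (‖ξ‖ : ℝ)) f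

/-- The fractional Laplacian `(-Δ)^(a/2)`, with Fourier symbol `|ξ|^a`. -/
def fracLap (a : ℝ) (f : Plane → ℂ) : Plane → ℂ :=
  fourierMult (fun ξ => ((‖ξ‖ ^ a : ℝ) : ℂ)) f

/-- The dispersive group `e^{-A t R₁}`, Fourier symbol `e^{-A t i ξ₁ / |ξ|}`. -/
def dispSg (A t : ℝ) (f : Plane → ℂ) : Plane → ℂ :=
  fourierMult (fun ξ => Complex.exp (-(A * t) * Complex.I * (ξ 0 : ℝ) / (‖ξ‖ : ℝ))) f

/-- The fractional heat semigroup `e^{-κ t (-Δ)^{α/2}}`, symbol `e^{-κ t |ξ|^α}`. -/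
def heatSg (κ α t : ℝ) (f : Plane → ℂ) : Plane → ℂ :=
  fourierMult (fun ξ => ((Real.exp (-(κ * t * ‖ξ‖ ^ α)) : ℝ) : ℂ)) f

/-- The linear propagator `T_A(t) = e^{-κ t (-Δ)^{α/2}} e^{-A t R₁}`. -/
def propag (κ α A t : ℝ) (f : Plane → ℂ) : Plane → ℂ :=
  heatSg κ α t (dispSg A t f)

/-- A homogeneous Littlewood–Paley decomposition on `ℝ²`, given by the
Fourier symbol `ψ = φ̂₀` of the basic dyadic block. -/
structure LP where
  ψ : Plane → ℝ
  smooth : ContDiff ℝ (⊤ : ℕ∞) ψ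
  supp : ∀ ξ : Plane, ψ ξ ≠ 0 → 2⁻¹ ≤ ‖ξ‖ ∧ ‖ξ‖ ≤ 2
  nonneg : ∀ ξ, 0 ≤ ψ ξ
  le_one : ∀ ξ, ψ ξ ≤ 1
  sum_one : ∀ ξ : Plane, ξ ≠ 0 → HasSum (fun j : ℤ => ψ ((2 : ℝ) ^ (-j) • ξ)) 1

/-- The Littlewood–Paley block `Δ_j`. -/
def LP.proj (P : LP) (j : ℤ) (f : Plane → ℂ) : Plane → ℂ :=
  fourierMult (fun ξ => ((P.ψ ((2 : ℝ) ^ (-j) • ξ) : ℝ) : ℂ)) f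

/-- The low-frequency cut-off `S_j = Σ_{k ≤ j-3} Δ_k`. -/
def LP.low (P : LP) (j : ℤ) (f : Plane → ℂ) : Plane → ℂ :=
  fun x => ∑' k : ℤ, if k ≤ j - 3 then P.proj k f x else 0

/-- The Bony paraproduct `T_f g = Σ_l S_l f Δ_l g`. -/
def LP.para (P : LP) (f g : Plane → ℂ) : Plane → ℂ :=
  fun x => ∑' l : ℤ, P.low l f x * P.proj l g x

/-- The Bony remainder `R(f,g) = Σ_l Σ_{|k-l|≤2} Δ_k f Δ_l g`. -/
def LP.rem (P : LP) (f g : Plane → ℂ) : Plane → ℂ :=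
  fun x => ∑' l : ℤ, ∑ k ∈ Finset.Icc (l - 2) (l + 2), P.proj k f x * P.proj l g x

/-- The `ℓ^q(ℤ)` norm of a family of extended nonnegative reals. -/
def lqNorm (q : ℝ≥0∞) (a : ℤ → ℝ≥0∞) : ℝ≥0∞ :=
  if q = ∞ then ⨆ j, a j else (∑' j : ℤ, a j ^ q.toReal) ^ (1 / q.toReal)

/-- The homogeneous Besov norm `‖f‖_{Ḃ^s_{p,q}}` associated to the
Littlewood–Paley decomposition `P`. -/
def besovNorm (P : LP) (s : ℝ) (p q : ℝ≥0∞) (f : Plane → ℂ) : ℝ≥0∞ :=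
  lqNorm q (fun j => ENNReal.ofReal ((2 : ℝ) ^ (s * (j : ℝ))) * eLpNorm (P.proj j f) p volume)

/-- The homogeneous Sobolev norm `‖f‖_{Ḣ^s} = ‖f‖_{Ḃ^s_{2,2}}`. -/
def sobolevNorm (P : LP) (s : ℝ) (f : Plane → ℂ) : ℝ≥0∞ :=
  besovNorm P s 2 2 f

/-- The homogeneous Sobolev norm via the Fourier transform:
`‖f‖_{Ḣ^s} = ‖ |ξ|^s (𝓕 f)(ξ) ‖_{L²}`. -/
def hNorm (s : ℝ) (f : Plane → ℂ) : ℝ≥0∞ :=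
  (∫⁻ ξ : Plane, ENNReal.ofReal (‖ξ‖ ^ (2 * s)) * (‖𝓕 f ξ‖₊ : ℝ≥0∞) ^ (2 : ℕ)) ^ (1 / 2 : ℝ)

/-- The `L^r` norm in time on `(0,∞)` of an `ℝ≥0∞`-valued quantity. -/
def timeLq (r : ℝ≥0∞) (g : ℝ → ℝ≥0∞) : ℝ≥0∞ :=
  if r = ∞ then essSup g (volume.restrict (Set.Ioi (0 : ℝ)))
  else (∫⁻ t in Set.Ioi (0 : ℝ), g t ^ r.toReal) ^ (1 / r.toReal)

/-- The Chemin–Lerner norm `‖F‖_{L̃^r(0,∞;Ḃ^s_{p,q})}`. -/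
def cheminLerner (P : LP) (s : ℝ) (p q r : ℝ≥0∞) (F : ℝ → Plane → ℂ) : ℝ≥0∞ :=
  lqNorm q (fun j => ENNReal.ofReal ((2 : ℝ) ^ (s * (j : ℝ))) *
    timeLq r (fun t => eLpNorm (P.proj j (F t)) p volume))

/-- Standard basis vector of the plane. -/
def ed (i : Fin 2) : Plane := EuclideanSpace.single i 1

/-- The advection term `u·∇θ = u₁ ∂₁θ + u₂ ∂₂θ` (classical derivatives). -/
def advect (u : Fin 2 → Plane → ℂ) (θ : Plane → ℂ) (x : Plane) : ℂ :=
  u 0 x * fderiv ℝ θ x (ed 0) + u 1 x * fderiv ℝ θ x (ed 1)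

/-- The quasi-geostrophic velocity `u = R^⊥θ = (−R₂θ, R₁θ)`. -/
def qgVel (θ : Plane → ℂ) : Fin 2 → Plane → ℂ :=
  ![fun x => -(riesz 1 θ x), fun x => riesz 0 θ x]

/-- `θ` is a (pointwise classical) solution of the 2D dissipative dispersive
quasi-geostrophic equation `∂_t θ + κ(-Δ)^{α/2}θ + u·∇θ + A u₂ = 0`,
`u = (−R₂θ, R₁θ)`, on `(0,∞) × ℝ²`. -/
def IsQGSol (κ α A : ℝ) (θ : ℝ → Plane → ℂ) : Prop :=
  ∀ t > (0 : ℝ), ∀ x : Plane,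
    HasDerivAt (fun τ => θ τ x)
      (-(κ • fracLap α (θ t) x + advect (qgVel (θ t)) (θ t) x + A • riesz 0 (θ t) x)) t


/-- The partial derivative `∂_i`, as a Fourier multiplier with symbol `i ξ_i`. -/
def fDeriv (i : Fin 2) (f : Plane → ℂ) : Plane → ℂ :=
  fourierMult (fun ξ => Complex.I * (ξ i : ℝ)) f

/-- The unit-frequency block `Δ̃₀ = Δ_{-1} + Δ₀ + Δ₁`. -/
def tdel (P : LP) (g : Plane → ℂ) : Plane → ℂ :=
  fun x => P.proj (-1) g x + P.proj 0 g x + P.proj 1 g x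

end
section

open scoped SchwartzMap

theorem plancherel_ae (F : Plane → ℂ) (h1 : Integrable F) (h2 : MemLp F 2 volume) :
    (((𝓕⁻ (h2.toLp F) : Lp ℂ 2 (volume : Measure Plane))) : Plane → ℂ) =ᵐ[volume] 𝓕⁻ F := by
  have hcont : Continuous (𝓕⁻ F) := by
    rw [Real.fourierInv_eq_fourier_comp_neg]
    exact VectorFourier.fourierIntegral_continuous Real.continuous_fourierChar
      (by exact continuous_inner) h1.comp_neg
  apply ae_eq_of_integral_contDiff_smul_eq
  · exact (Lp.memLp _).locallyIntegrable (by norm_num)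
  · exact hcont.locallyIntegrable
  intro g hg hgc
  have hg' : ContDiff ℝ ((⊤ : ℕ∞) : WithTop ℕ∞) (fun x => (g x : ℂ)) := by
    exact Complex.ofRealCLM.contDiff.comp hg
  have hgc' : HasCompactSupport (fun x => (g x : ℂ)) := by
    exact hgc.comp_left (g := fun y : ℝ => (y : ℂ)) (by simp)
  let φ : 𝓢(Plane, ℂ) := hgc'.toSchwartzMap hg'
  have hφ : ∀ x, φ x = (g x : ℂ) := fun x => rfl
  have key := congrArg (fun T => T φ) (Lp.fourierInv_toTemperedDistribution_eq (h2.toLp F))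
  simp only [TemperedDistribution.fourierInv_apply, Lp.toTemperedDistribution_apply] at key
  have e1 : ∫ x, g x • (((𝓕⁻ (h2.toLp F) : Lp ℂ 2 (volume : Measure Plane))) : Plane → ℂ) x
      = ∫ x, φ x • (((𝓕⁻ (h2.toLp F) : Lp ℂ 2 (volume : Measure Plane))) : Plane → ℂ) x := by
    refine integral_congr_ae (Eventually.of_forall fun x => ?_)
    simp [hφ]
  rw [e1, ← key]
  have e2 : ∫ x, (𝓕⁻ φ) x • (h2.toLp F) x = ∫ x, (𝓕⁻ φ) x • F x := by
    refine integral_congr_ae ?_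
    filter_upwards [h2.coeFn_toLp] with x hx
    rw [hx]
  rw [e2]
  have e3 : ∫ x, g x • 𝓕⁻ F x = ∫ x, φ x • 𝓕⁻ F x := by
    refine integral_congr_ae (Eventually.of_forall fun x => ?_)
    simp [hφ]
  rw [e3]
  have h3 := VectorFourier.integral_fourierIntegral_smul_eq_flip (e := Real.fourierChar)
     (L := -(innerₗ Plane)) (μ := volume) (ν := volume) (f := φ) (g := F) Real.continuous_fourierChar
     (by simp only [LinearMap.neg_apply]; exact continuous_inner.neg) φ.integrable h1
  have h4 : ∀ (G : Plane → ℂ), VectorFourier.fourierIntegral Real.fourierChar volume (-(innerₗ Plane)) G = 𝓕⁻ G := by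
    intro G; ext w
    simp [VectorFourier.fourierIntegral, Real.fourierInv_eq]
  have h5 : (-(innerₗ Plane)).flip = -(innerₗ Plane) := by
    ext x y; simp [real_inner_comm]
  rw [h5, h4, h4] at h3
  rw [← SchwartzMap.fourierInv_coe] at h3
  exact h3

theorem plancherel_inv (F : Plane → ℂ) (h1 : Integrable F) (h2 : MemLp F 2 volume) :
    eLpNorm (𝓕⁻ F) 2 volume = eLpNorm F 2 volume := by
  rw [← eLpNorm_congr_ae (plancherel_ae F h1 h2), ← eLpNorm_congr_ae h2.coeFn_toLp]
  have h : ‖(𝓕⁻ (h2.toLp F) : Lp ℂ 2 (volume : Measure Plane))‖ = ‖h2.toLp F‖ := 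
    (Lp.fourierTransformₗᵢ Plane ℂ).symm.norm_map _
  rw [Lp.norm_def, Lp.norm_def] at h
  exact (ENNReal.toReal_eq_toReal_iff' (Lp.eLpNorm_ne_top _) (Lp.eLpNorm_ne_top _)).1 h

theorem fourier_cont (f : Plane → ℂ) (h1 : Integrable f) : Continuous (𝓕 f) :=
  VectorFourier.fourierIntegral_continuous Real.continuous_fourierChar
      (by exact continuous_inner) h1

theorem fourier_zero_of_not (f : Plane → ℂ) (h1 : ¬ Integrable f) : 𝓕 f = fun _ => 0 := by
  ext w
  rw [Real.fourier_eq]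
  apply integral_undef
  rwa [Real.fourierIntegral_convergent_iff]

theorem fourier_cont' (f : Plane → ℂ) : Continuous (𝓕 f) := by
  by_cases h : Integrable f
  · exact fourier_cont f h
  · rw [fourier_zero_of_not f h]; exact continuous_const

theorem fourierInv_zero_of_not (f : Plane → ℂ) (h1 : ¬ Integrable f) : 𝓕⁻ f = fun _ => 0 := by
  rw [Real.fourierInv_eq_fourier_comp_neg]
  apply fourier_zero_of_not
  intro h
  exact h1 (by simpa using h.comp_neg)

theorem fourierInv_zero' : 𝓕⁻ (fun _ : Plane => (0:ℂ)) = fun _ => 0 := by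
  ext w; simp [Real.fourierInv_eq]

theorem fourier_zero_plane : 𝓕 (fun _ : Plane => (0:ℂ)) = fun _ => 0 := by
  ext w; simp [Real.fourier_eq]

theorem mult_comp (m h : Plane → ℂ) (hc : ∀ ξ, ξ ≠ 0 → ContinuousAt h ξ) :
    fourierMult m (𝓕⁻ h) = (fun _ => 0) ∨ fourierMult m (𝓕⁻ h) = 𝓕⁻ (fun ξ => m ξ * h ξ) := by
  unfold fourierMult
  by_cases h1 : Integrable h
  swap
  · left
    rw [fourierInv_zero_of_not h h1, fourier_zero_plane]
    simp [fourierInv_zero']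
  by_cases h2 : Integrable (𝓕⁻ h)
  swap
  · left
    rw [fourier_zero_of_not _ h2]
    simp [fourierInv_zero']
  right
  have h3 : Integrable (𝓕 h) := by
    have : 𝓕 h = fun x => 𝓕⁻ h (-x) := by
      ext x; rw [Real.fourierInv_eq_fourier_neg]; simp
    rw [this]; exact h2.comp_neg
  have h4 : ∀ ξ, ξ ≠ 0 → 𝓕 (𝓕⁻ h) ξ = h ξ := fun ξ hξ => h1.fourier_fourierInv_eq h3 (hc ξ hξ)
  ext x
  rw [Real.fourierInv_eq, Real.fourierInv_eq]
  apply integral_congr_ae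
  have : ∀ᵐ ξ : Plane, ξ ≠ 0 := by
    simp [ae_iff]
  filter_upwards [this] with ξ hξ
  rw [h4 ξ hξ]

/-- dispersive symbol -/
noncomputable def dsym (A t : ℝ) (ξ : Plane) : ℂ :=
  Complex.exp (-(A * t) * Complex.I * (ξ 0 : ℝ) / (‖ξ‖ : ℝ))

/-- heat symbol -/
noncomputable def hsym (κ α t : ℝ) (ξ : Plane) : ℂ :=
  ((Real.exp (-(κ * t * ‖ξ‖ ^ α)) : ℝ) : ℂ)

theorem dsym_cont (A t : ℝ) (ξ : Plane) (hξ : ξ ≠ 0) : ContinuousAt (dsym A t) ξ := by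
  unfold dsym
  apply ContinuousAt.cexp
  apply ContinuousAt.div
  · fun_prop
  · fun_prop
  · simpa using hξ

theorem hsym_cont (κ α t : ℝ) (hα : 0 < α) : Continuous (hsym κ α t) := by
  unfold hsym
  apply Complex.continuous_ofReal.comp
  apply Real.continuous_exp.comp
  apply Continuous.neg
  apply Continuous.mul continuous_const
  exact continuous_norm.rpow_const (fun x => Or.inr hα.le)

/-- LP symbol times Fourier transform -/
noncomputable def blk (P : LP) (j : ℤ) (f : Plane → ℂ) (ξ : Plane) : ℂ :=
  ((P.ψ ((2 : ℝ) ^ (-j) • ξ) : ℝ) : ℂ) * 𝓕 f ξ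

theorem proj_eq (P : LP) (j : ℤ) (f : Plane → ℂ) : P.proj j f = 𝓕⁻ (blk P j f) := rfl

theorem proj_propag (P : LP) (κ α A t : ℝ) (hα : 0 < α) (j : ℤ) (f : Plane → ℂ) :
    P.proj j (propag κ α A t f) = (fun _ => 0) ∨
    P.proj j (propag κ α A t f) = 𝓕⁻ (fun ξ => hsym κ α t ξ * dsym A t ξ * blk P j f ξ) := by
  have hd : ∀ ξ, ξ ≠ 0 → ContinuousAt (fun ξ => dsym A t ξ * 𝓕 f ξ) ξ := fun ξ hξ =>
    (dsym_cont A t ξ hξ).mul (fourier_cont' f).continuousAt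
  have e1 : propag κ α A t f = fourierMult (hsym κ α t) (𝓕⁻ (fun ξ => dsym A t ξ * 𝓕 f ξ)) := rfl
  rcases mult_comp (hsym κ α t) _ hd with h | h
  · left
    rw [e1, h]
    unfold LP.proj fourierMult
    rw [fourier_zero_plane]
    simp [fourierInv_zero']
  · rw [e1, h]
    have hd2 : ∀ ξ, ξ ≠ 0 → ContinuousAt (fun ξ => hsym κ α t ξ * (dsym A t ξ * 𝓕 f ξ)) ξ := 
      fun ξ hξ => (hsym_cont κ α t hα).continuousAt.mul (hd ξ hξ)
    rcases mult_comp (fun ξ => ((P.ψ ((2 : ℝ) ^ (-j) • ξ) : ℝ) : ℂ)) _ hd2 with h' | h'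
    · left; exact h'
    · right
      refine h'.trans ?_
      congr 1
      ext ξ
      simp only [blk]; ring

theorem blk_cont (P : LP) (j : ℤ) (f : Plane → ℂ) : Continuous (blk P j f) := by
  unfold blk
  have := P.smooth.continuous
  have := fourier_cont' f
  fun_prop

theorem blk_supp (P : LP) (j : ℤ) (f : Plane → ℂ) (ξ : Plane) (h : blk P j f ξ ≠ 0) :
    (2:ℝ)^j / 2 ≤ ‖ξ‖ ∧ ‖ξ‖ ≤ 2 * (2:ℝ)^j := by
  have h1 : P.ψ ((2 : ℝ) ^ (-j) • ξ) ≠ 0 := by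
    intro h'; apply h; unfold blk; rw [h']; simp
  have h2 := P.supp _ h1
  have h3 : ‖(2 : ℝ) ^ (-j) • ξ‖ = ((2:ℝ)^j)⁻¹ * ‖ξ‖ := by
    rw [norm_smul, zpow_neg]; simp
  have h4 : (0:ℝ) < (2:ℝ)^j := by positivity
  rw [h3] at h2
  obtain ⟨a, b⟩ := h2
  rw [inv_mul_eq_div] at a b
  rw [le_div_iff₀ h4] at a
  rw [div_le_iff₀ h4] at b
  exact ⟨by linarith, b⟩

theorem bes_tail (R ε : ℝ) (hR : R ≠ 0) (h0 : 0 < ε) (h1 : ε ≤ Real.pi / 2) :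
    ‖∫ θ in ε..(Real.pi/2), Complex.exp (Complex.I * (R * Real.cos θ : ℝ))‖ ≤ Real.pi / (ε * |R|) := by
  have hs : ∀ θ ∈ Set.uIcc ε (Real.pi/2), 0 < Real.sin θ := by
    intro θ hθ
    rw [Set.uIcc_of_le h1] at hθ
    exact Real.sin_pos_of_pos_of_lt_pi (by linarith [hθ.1]) (by linarith [hθ.2, Real.pi_pos])
  have hc : ∀ θ ∈ Set.uIcc ε (Real.pi/2), 0 ≤ Real.cos θ := by
    intro θ hθ
    rw [Set.uIcc_of_le h1] at hθ
    exact Real.cos_nonneg_of_mem_Icc ⟨by linarith [hθ.1, Real.pi_pos], hθ.2⟩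
  have hh : ∀ θ ∈ Set.uIcc ε (Real.pi/2), HasDerivAt (fun θ => (Real.sin θ)⁻¹) (-Real.cos θ / Real.sin θ ^ 2) θ := by
    intro θ hθ
    exact (Real.hasDerivAt_sin θ).inv (hs θ hθ).ne'
  have hu : ∀ θ ∈ Set.uIcc ε (Real.pi/2), HasDerivAt (fun θ => (((Real.sin θ)⁻¹ : ℝ) : ℂ)) ((-Real.cos θ / Real.sin θ ^ 2 : ℝ) : ℂ) θ := by
    intro θ hθ
    exact (hh θ hθ).ofReal_comp
  have hv : ∀ θ ∈ Set.uIcc ε (Real.pi/2), HasDerivAt (fun θ : ℝ => Complex.exp (Complex.I * (R * Real.cos θ : ℝ)))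
      (Complex.exp (Complex.I * (R * Real.cos θ : ℝ)) * (Complex.I * (R * (-Real.sin θ) : ℝ))) θ := by
    intro θ hθ
    have : HasDerivAt (fun θ => R * Real.cos θ) (R * (-Real.sin θ)) θ := (Real.hasDerivAt_cos θ).const_mul R
    exact ((this.ofReal_comp).const_mul Complex.I).cexp
  have hcont : ContinuousOn (fun θ => -Real.cos θ / Real.sin θ ^ 2) (Set.uIcc ε (Real.pi/2)) := by
    apply ContinuousOn.div
    · fun_prop
    · fun_prop
    · intro θ hθ; exact pow_ne_zero _ (hs θ hθ).ne'
  have ibp := intervalIntegral.integral_mul_deriv_eq_deriv_mul hu hv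
    (Complex.continuous_ofReal.comp_continuousOn hcont).intervalIntegrable
    (Continuous.intervalIntegrable (by fun_prop) _ _)
  have e1 : ∫ θ in ε..(Real.pi/2), (((Real.sin θ)⁻¹ : ℝ) : ℂ) * (Complex.exp (Complex.I * (R * Real.cos θ : ℝ)) * (Complex.I * (R * (-Real.sin θ) : ℝ)))
     = (-(Complex.I * R)) * ∫ θ in ε..(Real.pi/2), Complex.exp (Complex.I * (R * Real.cos θ : ℝ)) := by
    rw [← intervalIntegral.integral_const_mul]
    apply intervalIntegral.integral_congr
    intro θ hθ
    have : ((Real.sin θ : ℝ) : ℂ) ≠ 0 := by exact_mod_cast (hs θ hθ).ne'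
    simp only
    push_cast at this ⊢
    field_simp
  rw [e1] at ibp
  have nexp : ∀ x : ℝ, ‖Complex.exp (Complex.I * (x : ℝ))‖ = 1 := fun x => by
    rw [mul_comm]; exact Complex.norm_exp_ofReal_mul_I x
  have e2 : ‖∫ θ in ε..(Real.pi/2), ((-Real.cos θ / Real.sin θ ^ 2 : ℝ) : ℂ) * Complex.exp (Complex.I * (R * Real.cos θ : ℝ))‖
     ≤ (Real.sin ε)⁻¹ - 1 := by
    have e3 : ∫ θ in ε..(Real.pi/2), (-Real.cos θ / Real.sin θ ^ 2) = 1 - (Real.sin ε)⁻¹ := by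
      rw [intervalIntegral.integral_eq_sub_of_hasDerivAt hh hcont.intervalIntegrable]
      simp
    calc _ ≤ ∫ θ in ε..(Real.pi/2), Real.cos θ / Real.sin θ ^ 2 := by
          apply intervalIntegral.norm_integral_le_of_norm_le h1
          · refine Eventually.of_forall fun θ hθ => ?_
            have hθ' : θ ∈ Set.uIcc ε (Real.pi/2) := by
              rw [Set.uIcc_of_le h1]; exact ⟨hθ.1.le, hθ.2⟩
            rw [norm_mul, nexp, mul_one, Complex.norm_real, Real.norm_eq_abs, neg_div, abs_neg, abs_of_nonneg]
            have := hc θ hθ'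
            positivity
          · have := hcont.neg.intervalIntegrable (μ := volume)
            refine this.congr_ae (Eventually.of_forall fun θ => ?_)
            simp [neg_div]
      _ = -∫ θ in ε..(Real.pi/2), (-Real.cos θ / Real.sin θ ^ 2) := by
          rw [← intervalIntegral.integral_neg]; simp [neg_div]
      _ = _ := by rw [e3]; ring
  have e4 : |R| * ‖∫ θ in ε..(Real.pi/2), Complex.exp (Complex.I * (R * Real.cos θ : ℝ))‖ ≤ 2 * (Real.sin ε)⁻¹ := by
    have : ‖(-(Complex.I * R)) * ∫ θ in ε..(Real.pi/2), Complex.exp (Complex.I * (R * Real.cos θ : ℝ))‖ ≤ 1 + (Real.sin ε)⁻¹ + ((Real.sin ε)⁻¹ - 1) := by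
      rw [ibp]
      refine (norm_sub_le _ _).trans (add_le_add ((norm_sub_le _ _).trans (add_le_add ?_ ?_)) e2)
      · rw [norm_mul, nexp]; simp
      · rw [norm_mul, nexp, mul_one, Complex.norm_real, Real.norm_eq_abs, abs_of_pos]
        exact inv_pos.2 (hs ε Set.left_mem_uIcc)
    rw [norm_mul] at this
    simp only [norm_neg, norm_mul, Complex.norm_I, one_mul, Complex.norm_real, Real.norm_eq_abs] at this
    linarith
  have e5 : (Real.sin ε)⁻¹ ≤ Real.pi / (2 * ε) := by
    have := Real.mul_le_sin h0.le h1
    rw [inv_le_comm₀ (hs ε Set.left_mem_uIcc) (by positivity)]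
    calc _ = 2 / Real.pi * ε := by field_simp
      _ ≤ _ := this
  have hRp : 0 < |R| := abs_pos.2 hR
  rw [le_div_iff₀ (by positivity)]
  have : |R| * ‖∫ θ in ε..(Real.pi/2), Complex.exp (Complex.I * (R * Real.cos θ : ℝ))‖ ≤ Real.pi / ε := by
    refine e4.trans ?_
    calc _ ≤ 2 * (Real.pi / (2*ε)) := by gcongr
      _ = _ := by field_simp
  rw [le_div_iff₀ h0] at this
  linarith

theorem bes_quarter (R : ℝ) (hR : R ≠ 0) :
    ‖∫ θ in (0:ℝ)..(Real.pi/2), Complex.exp (Complex.I * (R * Real.cos θ : ℝ))‖ ≤ 5 * (√|R|)⁻¹ := by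
  have nexp : ∀ x : ℝ, ‖Complex.exp (Complex.I * (x : ℝ))‖ = 1 := fun x => by
    rw [mul_comm]; exact Complex.norm_exp_ofReal_mul_I x
  have hRp : 0 < |R| := abs_pos.2 hR
  have hpi := Real.pi_pos
  have hpi4 := Real.pi_lt_four
  have hpi3 := Real.pi_gt_three
  have triv : ∀ b : ℝ, 0 ≤ b → ‖∫ θ in (0:ℝ)..b, Complex.exp (Complex.I * (R * Real.cos θ : ℝ))‖ ≤ b := by
    intro b hb
    have := intervalIntegral.norm_integral_le_of_norm_le_const (a := 0) (b := b) (C := 1) 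
      (f := fun θ : ℝ => Complex.exp (Complex.I * (R * Real.cos θ : ℝ))) (fun x _ => (nexp _).le)
    simpa [abs_of_nonneg hb] using this
  rcases le_or_gt 1 |R| with h | h
  · set s := √|R| with hs
    have hs1 : 1 ≤ s := Real.one_le_sqrt.2 h
    have hs2 : s * s = |R| := Real.mul_self_sqrt hRp.le
    have hi : s⁻¹ ≤ 1 := inv_le_one_of_one_le₀ hs1
    have hs0 : 0 < s⁻¹ := by positivity
    have t := bes_tail R s⁻¹ hR hs0 (by linarith)
    rw [← intervalIntegral.integral_add_adjacent_intervals (a := 0) (b := s⁻¹)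
      (Continuous.intervalIntegrable (by fun_prop) _ _) (Continuous.intervalIntegrable (by fun_prop) _ _)]
    refine (norm_add_le _ _).trans ?_
    have e : Real.pi / (s⁻¹ * |R|) = Real.pi * s⁻¹ := by
      rw [← hs2]; field_simp
    rw [e] at t
    have := triv s⁻¹ hs0.le
    nlinarith
  · have := triv (Real.pi/2) (by positivity)
    have h3 : 1 ≤ (√|R|)⁻¹ := by
      apply (one_le_inv₀ (by positivity)).2
      exact Real.sqrt_le_one.2 h.le
    linarith

theorem bes_full (R : ℝ) (hR : R ≠ 0) :
    ‖∫ θ in (-Real.pi)..Real.pi, Complex.exp (Complex.I * (R * Real.cos θ : ℝ))‖ ≤ 20 * (√|R|)⁻¹ := by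
  have ii : ∀ a b, IntervalIntegrable (fun θ : ℝ => Complex.exp (Complex.I * (R * Real.cos θ : ℝ))) volume a b :=
    fun a b => Continuous.intervalIntegrable (by fun_prop) _ _
  have h1 : ∫ θ in (-Real.pi)..0, Complex.exp (Complex.I * (R * Real.cos θ : ℝ)) = ∫ θ in (0:ℝ)..Real.pi, Complex.exp (Complex.I * (R * Real.cos θ : ℝ)) := by
    have := intervalIntegral.integral_comp_neg (a := 0) (b := Real.pi) (fun θ : ℝ => Complex.exp (Complex.I * (R * Real.cos θ : ℝ)))
    simpa using this.symm
  have h2 : ∫ θ in (Real.pi/2)..Real.pi, Complex.exp (Complex.I * (R * Real.cos θ : ℝ)) = ∫ θ in (0:ℝ)..(Real.pi/2), Complex.exp (Complex.I * ((-R) * Real.cos θ : ℝ)) := by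
    have := intervalIntegral.integral_comp_sub_left (a := 0) (b := Real.pi/2) (fun θ : ℝ => Complex.exp (Complex.I * (R * Real.cos θ : ℝ))) Real.pi
    rw [sub_zero, sub_half] at this
    rw [← this]
    simp
  rw [← intervalIntegral.integral_add_adjacent_intervals (ii (-Real.pi) 0) (ii 0 Real.pi), h1,
    ← intervalIntegral.integral_add_adjacent_intervals (ii 0 (Real.pi/2)) (ii (Real.pi/2) Real.pi), h2]
  have q1 := bes_quarter R hR
  have q2 := bes_quarter (-R) (neg_ne_zero.2 hR)
  rw [abs_neg] at q2
  refine (norm_add_le _ _).trans ?_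
  have := (norm_add_le (∫ θ in (0:ℝ)..(Real.pi/2), Complex.exp (Complex.I * (R * Real.cos θ : ℝ))) (∫ θ in (0:ℝ)..(Real.pi/2), Complex.exp (Complex.I * ((-R) * Real.cos θ : ℝ))))
  linarith

theorem bes (a b : ℝ) (h : √(a^2+b^2) ≠ 0) :
    ‖∫ θ in (-Real.pi)..Real.pi, Complex.exp (Complex.I * (a * Real.cos θ + b * Real.sin θ : ℝ))‖ ≤ 20 * (√√(a^2+b^2))⁻¹ := by
  set z : ℂ := ⟨a, b⟩ with hz
  have hn : ‖z‖ = √(a^2+b^2) := by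
    rw [Complex.norm_def, Complex.normSq_apply]; congr 1; simp [hz]; ring
  have ha : a = ‖z‖ * Real.cos (Complex.arg z) := by rw [Complex.norm_mul_cos_arg]
  have hb : b = ‖z‖ * Real.sin (Complex.arg z) := by rw [Complex.norm_mul_sin_arg]
  have e : ∀ θ : ℝ, a * Real.cos θ + b * Real.sin θ = ‖z‖ * Real.cos (θ - Complex.arg z) := by
    intro θ
    rw [Real.cos_sub]
    calc _ = (‖z‖ * Real.cos (Complex.arg z)) * Real.cos θ + (‖z‖ * Real.sin (Complex.arg z)) * Real.sin θ := by rw [← ha, ← hb]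
      _ = _ := by ring
  simp_rw [e]
  rw [intervalIntegral.integral_comp_sub_right (fun θ : ℝ => Complex.exp (Complex.I * (‖z‖ * Real.cos θ : ℝ)))]
  have per : Function.Periodic (fun θ : ℝ => Complex.exp (Complex.I * (‖z‖ * Real.cos θ : ℝ))) (2 * Real.pi) := by
    intro θ; simp only [Real.cos_add_two_pi]
  have := per.intervalIntegral_add_eq (-Real.pi - z.arg) (-Real.pi)
  have e1 : -Real.pi - z.arg + 2 * Real.pi = Real.pi - z.arg := by ring
  have e2 : -Real.pi + 2 * Real.pi = Real.pi := by ring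
  rw [e1, e2] at this
  rw [this, ← hn]
  have := bes_full ‖z‖ (by rwa [hn])
  rwa [abs_norm] at this

theorem sing_half (L : ℝ) (hL : 0 < L) :
    ∫⁻ r in Set.Ioc 0 L, ENNReal.ofReal |r| ^ (-(1/2) : ℝ) = ENNReal.ofReal (2 * √L) := by
  have e : ∫⁻ r in Set.Ioc 0 L, ENNReal.ofReal |r| ^ (-(1/2) : ℝ) = ∫⁻ r in Set.Ioc 0 L, ENNReal.ofReal (r ^ (-(1/2) : ℝ)) := by
    apply setLIntegral_congr_fun measurableSet_Ioc
    intro r hr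
    simp only
    rw [abs_of_pos hr.1, ENNReal.ofReal_rpow_of_pos hr.1]
  have hi := intervalIntegral.intervalIntegrable_rpow' (a := 0) (b := L) (r := -(1/2)) (by norm_num)
  rw [e, ← ofReal_integral_eq_lintegral_ofReal]
  · rw [← intervalIntegral.integral_of_le hL.le, integral_rpow (Or.inl (by norm_num))]
    congr 1
    rw [Real.sqrt_eq_rpow, Real.zero_rpow (by norm_num)]
    norm_num
    ring
  · rwa [intervalIntegrable_iff_integrableOn_Ioc_of_le hL.le] at hi
  · exact (ae_restrict_iff' measurableSet_Ioc).2 (Eventually.of_forall fun r hr => Real.rpow_nonneg hr.1.le _)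

theorem sing_meas (m : Measure ℝ) (hm : m ≤ volume) (L a : ℝ) (hL : 0 < L)
    (hmass : m Set.univ ≤ ENNReal.ofReal L) :
    ∫⁻ r, ENNReal.ofReal |r - a| ^ (-(1/2) : ℝ) ∂m ≤ ENNReal.ofReal (5 * √L) := by
  set g : ℝ → ℝ≥0∞ := fun r => ENNReal.ofReal |r| ^ (-(1/2) : ℝ) with hg
  have gm : Measurable g := by
    apply Measurable.pow_const
    exact ENNReal.measurable_ofReal.comp (by fun_prop)
  have p : ∀ r, g r ≤ (Set.Ioc (-L) L).indicator g r + ENNReal.ofReal ((√L)⁻¹) := by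
    intro r
    by_cases hr : r ∈ Set.Ioc (-L) L
    · rw [Set.indicator_of_mem hr]; exact le_self_add
    · have : L ≤ |r| := by
        by_contra! h
        rw [abs_lt] at h
        exact hr ⟨h.1, h.2.le⟩
      refine le_trans ?_ le_add_self
      simp only [hg]
      rw [ENNReal.ofReal_rpow_of_pos (hL.trans_le this)]
      apply ENNReal.ofReal_le_ofReal
      rw [Real.sqrt_eq_rpow, ← Real.rpow_neg hL.le]
      exact Real.rpow_le_rpow_of_nonpos hL this (by norm_num)
  have i1 : ∫⁻ r in Set.Ioc (-L) L, g r = ENNReal.ofReal (4 * √L) := by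
    have hu : Set.Ioc (-L) L = Set.Ioc (-L) 0 ∪ Set.Ioc 0 L := by
      rw [Set.Ioc_union_Ioc_eq_Ioc] <;> linarith
    rw [hu, lintegral_union measurableSet_Ioc (by simp), sing_half L hL]
    have : ∫⁻ r in Set.Ioc (-L) 0, g r = ENNReal.ofReal (2 * √L) := by
      rw [← sing_half L hL]
      rw [← lintegral_indicator measurableSet_Ioc, ← lintegral_indicator measurableSet_Ioc,
        ← lintegral_neg_eq_self]
      apply lintegral_congr_ae
      have z : ∀ᵐ r : ℝ, r ≠ 0 := by simp [ae_iff]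
      have z' : ∀ᵐ r : ℝ, r ≠ L := by simp [ae_iff]
      filter_upwards [z, z'] with r h1 h2
      by_cases hr : r ∈ Set.Ioc 0 L
      · have h3 : -r ∈ Set.Ioc (-L) 0 := ⟨by
          have := lt_of_le_of_ne hr.2 h2
          linarith, by linarith [hr.1]⟩
        rw [Set.indicator_of_mem hr, Set.indicator_of_mem h3]
        simp [hg]
      · have h3 : -r ∉ Set.Ioc (-L) 0 := by
          intro h
          apply hr
          refine ⟨lt_of_le_of_ne (by linarith [h.2]) (Ne.symm h1), by linarith [h.1]⟩
        rw [Set.indicator_of_notMem hr, Set.indicator_of_notMem h3]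
    rw [this, ← ENNReal.ofReal_add (by positivity) (by positivity)]
    congr 1; ring
  calc ∫⁻ r, g (r - a) ∂m ≤ ∫⁻ r, ((Set.Ioc (-L) L).indicator g (r - a) + ENNReal.ofReal ((√L)⁻¹)) ∂m :=
        lintegral_mono fun r => p _
    _ = ∫⁻ r, (Set.Ioc (-L) L).indicator g (r - a) ∂m + ENNReal.ofReal ((√L)⁻¹) * m Set.univ := by
        rw [lintegral_add_right _ measurable_const, lintegral_const]
    _ ≤ (∫⁻ r, (Set.Ioc (-L) L).indicator g (r - a)) + ENNReal.ofReal ((√L)⁻¹) * ENNReal.ofReal L := by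
        gcongr
    _ = ENNReal.ofReal (4 * √L) + ENNReal.ofReal (√L) := by
        rw [lintegral_sub_right_eq_self ((Set.Ioc (-L) L).indicator g) a, lintegral_indicator measurableSet_Ioc, i1, ← ENNReal.ofReal_mul (by positivity)]
        congr 2
        rw [inv_mul_eq_div, Real.div_sqrt]
    _ = _ := by
        rw [← ENNReal.ofReal_add (by positivity) (by positivity)]
        congr 1; ring

theorem rad_int (l Y T : ℝ) (hl : 0 < l) (hY : 0 ≤ Y) (hT : 0 < T) :
    ∫⁻ r in Set.Icc (l/2) (2*l), ENNReal.ofReal |r * Y - T| ^ (-(1/2) : ℝ) ≤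
      ENNReal.ofReal (15 * l) * ENNReal.ofReal T ^ (-(1/2) : ℝ) := by
  have hvol : volume (Set.Icc (l/2) (2*l)) ≤ ENNReal.ofReal (2 * l) := by
    rw [Real.volume_Icc]; apply ENNReal.ofReal_le_ofReal; linarith
  have conv : ∀ z : ℝ, 0 < z → ENNReal.ofReal z ^ (-(1/2) : ℝ) = ENNReal.ofReal ((√z)⁻¹) := by
    intro z hz
    rw [ENNReal.ofReal_rpow_of_pos hz, Real.rpow_neg hz.le, Real.sqrt_eq_rpow]
  rcases le_or_gt (Y * l) (T / 4) with h | h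
  · calc _ ≤ ∫⁻ r in Set.Icc (l/2) (2*l), ENNReal.ofReal ((√(T/2))⁻¹) := by
          apply setLIntegral_mono measurable_const
          intro r hr
          rw [← conv _ (by positivity)]
          rw [ENNReal.rpow_neg, ENNReal.rpow_neg]
          apply ENNReal.inv_le_inv.2
          apply ENNReal.rpow_le_rpow _ (by norm_num)
          apply ENNReal.ofReal_le_ofReal
          have : r * Y ≤ 2 * l * Y := by gcongr; exact hr.2
          rw [abs_sub_comm]
          refine le_trans ?_ (le_abs_self _)
          nlinarith
      _ ≤ ENNReal.ofReal ((√(T/2))⁻¹) * ENNReal.ofReal (2 * l) := by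
          rw [setLIntegral_const]; gcongr
      _ ≤ _ := by
          rw [conv T hT, ← ENNReal.ofReal_mul (by positivity), ← ENNReal.ofReal_mul (by positivity)]
          apply ENNReal.ofReal_le_ofReal
          have h4 : √T / 2 ≤ √(T/2) := by
            apply Real.le_sqrt_of_sq_le
            rw [div_pow, Real.sq_sqrt hT.le]; linarith
          have h5 : (√(T/2))⁻¹ ≤ 2 * (√T)⁻¹ := by
            calc _ ≤ (√T/2)⁻¹ := by gcongr
              _ = _ := by field_simp
          have h6 : 0 < (√T)⁻¹ := by positivity
          nlinarith [mul_pos hl h6]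
  · have hYp : 0 < Y := by
      by_contra! hh
      have : Y = 0 := le_antisymm hh hY
      rw [this] at h; linarith
    have e : ∀ r : ℝ, ENNReal.ofReal |r * Y - T| ^ (-(1/2) : ℝ) = ENNReal.ofReal ((√Y)⁻¹) * ENNReal.ofReal |r - T / Y| ^ (-(1/2) : ℝ) := by
      intro r
      rw [← conv Y hYp]
      have : |r * Y - T| = Y * |r - T/Y| := by
        rw [← abs_of_pos hYp, ← abs_mul, abs_of_pos hYp]; congr 1; field_simp
      rw [this, ENNReal.ofReal_mul hY, ENNReal.mul_rpow_of_ne_top (by simp) (by simp)]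
    simp_rw [e]
    rw [lintegral_const_mul']
    swap; · simp
    calc _ ≤ ENNReal.ofReal ((√Y)⁻¹) * ENNReal.ofReal (5 * √(2*l)) := by
          gcongr
          apply sing_meas _ Measure.restrict_le_self _ _ (by positivity)
          simpa using hvol
      _ ≤ _ := by
          rw [conv T hT, ← ENNReal.ofReal_mul (by positivity), ← ENNReal.ofReal_mul (by positivity)]
          apply ENNReal.ofReal_le_ofReal
          have h1 : √T ≤ 2 * √(Y * l) := by
            have : √T ≤ √(4 * (Y*l)) := Real.sqrt_le_sqrt (by linarith)
            rw [Real.sqrt_mul (by norm_num)] at this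
            have h2 : √(4:ℝ) = 2 := by rw [show (4:ℝ) = 2^2 by norm_num]; simp
            rwa [h2] at this
          rw [Real.sqrt_mul hY] at h1
          rw [Real.sqrt_mul (by norm_num)]
          have h3 : √(2:ℝ) ≤ 3/2 := by
            rw [Real.sqrt_le_left (by norm_num)]; norm_num
          have h4 : √l * √l = l := Real.mul_self_sqrt hl.le
          have hp1 : 0 < √Y := by positivity
          have hp2 : 0 < √T := by positivity
          have hp3 : 0 < √l := by positivity
          rw [inv_mul_eq_div, ← div_eq_mul_inv, div_le_div_iff₀ hp1 hp2]
          calc 5 * (√2 * √l) * √T ≤ 5 * (3/2 * √l) * (2 * (√Y * √l)) := by gcongr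
            _ = 15 * (√l * √l) * √Y := by ring
            _ = _ := by rw [h4]

/-- dyadic annulus -/
def ann (l : ℝ) : Set Plane := {ξ | l / 2 ≤ ‖ξ‖ ∧ ‖ξ‖ ≤ 2 * l}

theorem ann_meas (l : ℝ) : MeasurableSet (ann l) := by
  apply MeasurableSet.inter
  · exact measurableSet_le measurable_const measurable_norm
  · exact measurableSet_le measurable_norm measurable_const

theorem ker_bound (l : ℝ) (hl : 0 < l) (τ : ℝ) (x : Plane) (w : ℝ → ℝ)
    (hw : ∀ r, l / 2 ≤ r → r ≤ 2 * l → |w r| ≤ 1) :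
    ‖∫ ξ in ann l, Complex.exp (Complex.I * (2 * Real.pi * inner ℝ ξ x - τ * (ξ 0 / ‖ξ‖) : ℝ)) * (w ‖ξ‖ : ℝ)‖ₑ
      ≤ ENNReal.ofReal (600 * l ^ 2) * ENNReal.ofReal |τ| ^ (-(1/2) : ℝ) := by
  rcases eq_or_ne τ 0 with h0 | h0
  · subst h0
    have : (ENNReal.ofReal |(0:ℝ)|) ^ (-(1/2) : ℝ) = ⊤ := by
      rw [abs_zero, ENNReal.ofReal_zero]; exact ENNReal.zero_rpow_of_neg (by norm_num)
    rw [this, ENNReal.mul_top]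
    · exact le_top
    · simp; positivity
  rw [← integral_indicator (ann_meas l)]
  have mp := Complex.orthonormalBasisOneI.measurePreserving_repr
  rw [← mp.integral_comp (Complex.orthonormalBasisOneI.repr.toHomeomorph.measurableEmbedding),
    ← Complex.integral_comp_polarCoord_symm, polarCoord_target]
  set G : ℝ × ℝ → ℂ := fun p => p.1 • (ann l).indicator (fun ξ : Plane => Complex.exp (Complex.I * (2 * Real.pi * inner ℝ ξ x - τ * (ξ 0 / ‖ξ‖) : ℝ)) * (w ‖ξ‖ : ℝ)) (Complex.orthonormalBasisOneI.repr (Complex.polarCoord.symm p)) with hG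
  have hGv : ∀ r ∈ Set.Ioi (0:ℝ), ∀ θ, G (r, θ) = (Set.Icc (l/2) (2*l)).indicator (fun r => ((r * w r : ℝ) : ℂ)) r *
      Complex.exp (Complex.I * ((2 * Real.pi * r * x 0 - τ) * Real.cos θ + (2 * Real.pi * r * x 1) * Real.sin θ : ℝ)) := by
    intro r hr θ
    have hr' : 0 < r := hr
    set ξ : Plane := Complex.orthonormalBasisOneI.repr (Complex.polarCoord.symm (r, θ)) with hξ
    have hn : ‖ξ‖ = r := by
      rw [hξ, LinearIsometryEquiv.norm_map, Complex.norm_polarCoord_symm, abs_of_pos hr']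
    have c0 : ξ 0 = r * Real.cos θ := by
      simp [hξ, Complex.cos_ofReal_re, Complex.sin_ofReal_re]
    have c1 : ξ 1 = r * Real.sin θ := by
      simp [hξ, Complex.cos_ofReal_re, Complex.sin_ofReal_re]
    have hmem : ξ ∈ ann l ↔ r ∈ Set.Icc (l/2) (2*l) := by
      simp [ann, hn]
    simp only [hG]
    rw [← hξ]
    by_cases hm : r ∈ Set.Icc (l/2) (2*l)
    · rw [Set.indicator_of_mem (hmem.2 hm), Set.indicator_of_mem hm, hn, c0, real_smul]
      have : inner ℝ ξ x = r * Real.cos θ * x 0 + r * Real.sin θ * x 1 := by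
        rw [PiLp.inner_apply, Fin.sum_univ_two, c0, c1]; simp; ring
      rw [this]
      have e : 2 * Real.pi * (r * Real.cos θ * x 0 + r * Real.sin θ * x 1) - τ * (r * Real.cos θ / r) = (2 * Real.pi * r * x 0 - τ) * Real.cos θ + (2 * Real.pi * r * x 1) * Real.sin θ := by
        field_simp; ring
      rw [e]; push_cast; ring
    · rw [Set.indicator_of_notMem (fun h => hm (hmem.1 h)), Set.indicator_of_notMem hm]; simp
  change ‖∫ p in Set.Ioi (0 : ℝ) ×ˢ Set.Ioo (-Real.pi) Real.pi, G p‖ₑ ≤ _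
  rw [Measure.volume_eq_prod]
  by_cases hi : IntegrableOn G (Set.Ioi (0 : ℝ) ×ˢ Set.Ioo (-Real.pi) Real.pi) (volume.prod volume)
  swap
  · rw [integral_undef hi]; simp
  rw [setIntegral_prod G hi]
  refine (enorm_integral_le_lintegral_enorm _).trans ?_
  have T0 : 0 < |τ| := abs_pos.2 h0
  set Y := 2 * Real.pi * ‖x‖ with hY
  have step : ∀ r ∈ Set.Ioi (0:ℝ), ‖∫ θ in Set.Ioo (-Real.pi) Real.pi, G (r, θ)‖ₑ ≤ 
      (Set.Icc (l/2) (2*l)).indicator (fun r => ENNReal.ofReal (40 * l) * ENNReal.ofReal |r * Y - (|τ|)| ^ (-(1/2) : ℝ)) r := by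
    intro r hr
    have hr' : 0 < r := hr
    simp_rw [hGv r hr]
    rw [integral_const_mul]
    by_cases hm : r ∈ Set.Icc (l/2) (2*l)
    swap
    · rw [Set.indicator_of_notMem hm]; simp
    rw [Set.indicator_of_mem hm, Set.indicator_of_mem hm]
    by_cases hz : |r * Y - (|τ|)| = 0
    · rw [hz, ENNReal.ofReal_zero, ENNReal.zero_rpow_of_neg (by norm_num), ENNReal.mul_top]
      · exact le_top
      · simp; positivity
    have hzp : 0 < |r * Y - (|τ|)| := lt_of_le_of_ne (abs_nonneg _) (Ne.symm hz)
    set a := 2 * Real.pi * r * x 0 - τ with ha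
    set b := 2 * Real.pi * r * x 1 with hb
    have hge : |r * Y - (|τ|)| ≤ √(a^2+b^2) := by
      apply Real.abs_le_sqrt
      have hx : ‖x‖^2 = x 0 ^ 2 + x 1 ^ 2 := by
        rw [EuclideanSpace.norm_sq_eq, Fin.sum_univ_two]; simp
      have hxa : |x 0| ≤ ‖x‖ := by
        apply abs_le_of_sq_le_sq _ (norm_nonneg x)
        rw [hx]; nlinarith [sq_nonneg (x 1)]
      have h3 : τ * x 0 ≤ |τ| * ‖x‖ := by
        calc _ ≤ |τ * x 0| := le_abs_self _
          _ = |τ| * |x 0| := abs_mul _ _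
          _ ≤ _ := by gcongr
      have h4 : |τ|^2 = τ^2 := sq_abs τ
      rw [hY, ha, hb]
      have h5 : 0 ≤ 4 * Real.pi * r := by positivity
      have h6 := mul_le_mul_of_nonneg_left h3 h5
      have e1 : (r * (2 * Real.pi * ‖x‖) - |τ|)^2 = 4 * Real.pi^2 * r^2 * ‖x‖^2 - 4 * Real.pi * r * (|τ| * ‖x‖) + |τ|^2 := by ring
      have e2 : (2 * Real.pi * r * x 0 - τ)^2 + (2 * Real.pi * r * x 1)^2 = 4 * Real.pi^2 * r^2 * (x 0 ^ 2 + x 1 ^ 2) - 4 * Real.pi * r * (τ * x 0) + τ^2 := by ring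
      rw [e1, e2, hx, h4]; linarith
    have hsq : 0 < √(a^2+b^2) := hzp.trans_le hge
    have B := bes a b hsq.ne'
    rw [intervalIntegral.integral_of_le (by linarith [Real.pi_pos]), integral_Ioc_eq_integral_Ioo] at B
    rw [ENNReal.ofReal_rpow_of_pos hzp, ← ENNReal.ofReal_mul (by positivity), ← ofReal_norm]
    apply ENNReal.ofReal_le_ofReal
    rw [norm_mul]
    have h1 : ‖((r * w r : ℝ) : ℂ)‖ ≤ 2 * l := by
      rw [Complex.norm_real, Real.norm_eq_abs, abs_mul, abs_of_pos hr']
      have := hw r hm.1 hm.2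
      calc r * |w r| ≤ (2*l) * 1 := by gcongr; exact hm.2
        _ = _ := by ring
    have h2 : (√√(a^2+b^2))⁻¹ ≤ |r * Y - (|τ|)| ^ (-(1/2) : ℝ) := by
      rw [Real.rpow_neg hzp.le, ← Real.sqrt_eq_rpow]
      gcongr
    calc _ ≤ (2 * l) * (20 * |r * Y - (|τ|)| ^ (-(1/2) : ℝ)) := by
          gcongr
          exact B.trans (by gcongr)
      _ = _ := by ring
  calc _ ≤ ∫⁻ r in Set.Ioi (0:ℝ), (Set.Icc (l/2) (2*l)).indicator (fun r => ENNReal.ofReal (40 * l) * ENNReal.ofReal |r * Y - (|τ|)| ^ (-(1/2) : ℝ)) r := 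
        setLIntegral_mono' measurableSet_Ioi step
    _ ≤ ∫⁻ r, (Set.Icc (l/2) (2*l)).indicator (fun r => ENNReal.ofReal (40 * l) * ENNReal.ofReal |r * Y - (|τ|)| ^ (-(1/2) : ℝ)) r :=
        setLIntegral_le_lintegral _ _
    _ = ENNReal.ofReal (40 * l) * ∫⁻ r in Set.Icc (l/2) (2*l), ENNReal.ofReal |r * Y - (|τ|)| ^ (-(1/2) : ℝ) := by
        rw [lintegral_indicator measurableSet_Icc, lintegral_const_mul' _ _ ENNReal.ofReal_ne_top]
    _ ≤ ENNReal.ofReal (40 * l) * (ENNReal.ofReal (15 * l) * ENNReal.ofReal |τ| ^ (-(1/2) : ℝ)) := by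
        gcongr
        exact rad_int l Y |τ| hl (by positivity) T0
    _ = _ := by
        rw [← mul_assoc, ← ENNReal.ofReal_mul (by positivity)]
        congr 2; ring

theorem sq_conj {X : Type*} [MeasurableSpace X] (μ : Measure X) [IsFiniteMeasure μ] (g : X → ℂ)
    (hg : Measurable g) (M : ℝ) (hM : ∀ x, ‖g x‖ ≤ M) :
    ∫⁻ x, ‖g x‖ₑ ^ 2 ∂μ = ‖∫ x, g x * (starRingEnd ℂ) (g x) ∂μ‖ₑ := by
  have e : ∀ x, g x * (starRingEnd ℂ) (g x) = ((‖g x‖^2 : ℝ) : ℂ) := by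
    intro x; rw [Complex.mul_conj, Complex.normSq_eq_norm_sq]
  simp_rw [e]
  rw [integral_complex_ofReal]
  have h0 : 0 ≤ ∫ x, ‖g x‖^2 ∂μ := integral_nonneg fun x => by positivity
  rw [← ofReal_norm, Complex.norm_real, Real.norm_eq_abs, abs_of_nonneg h0,
    ofReal_integral_eq_lintegral_ofReal]
  · congr 1; ext x
    rw [← ofReal_norm, ENNReal.ofReal_pow (norm_nonneg _)]
  · apply Integrable.of_bound (hg.norm.pow_const 2).aestronglyMeasurable (M^2)
    filter_upwards with x
    rw [Real.norm_eq_abs, abs_of_nonneg (by positivity)]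
    gcongr; exact hM x
  · filter_upwards with x; positivity

theorem swap_bdd {T X : Type*} [MeasurableSpace X] [MeasurableSpace T] (μ : Measure T) (ν : Measure X)
    [IsFiniteMeasure μ] [IsFiniteMeasure ν] (g : T → X → ℂ) (hg : Measurable (Function.uncurry g)) (M : ℝ)
    (hM : ∀ t x, ‖g t x‖ ≤ M) : ∫ t, ∫ x, g t x ∂ν ∂μ = ∫ x, ∫ t, g t x ∂μ ∂ν := by
  apply integral_integral_swap
  apply Integrable.of_bound hg.aestronglyMeasurable M
  filter_upwards with z
  exact hM z.1 z.2

theorem ttstar {T X : Type*} [MeasurableSpace X] [MeasurableSpace T] (μ : Measure T) (ν : Measure X)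
    [IsFiniteMeasure μ] [IsFiniteMeasure ν] (e : T → X → ℂ) (he : Measurable (Function.uncurry e))
    (hb : ∀ t x, ‖e t x‖ ≤ 1) (F : X → ℂ) (hF : Measurable F) (M : ℝ) (hM : ∀ x, ‖F x‖ ≤ M)
    (k : T → T → ℝ≥0∞) (hk : Measurable (Function.uncurry k)) (hsym : ∀ t s, k t s = k s t)
    (B : ℝ≥0∞) (hB : ∀ t, ∫⁻ s, k t s ∂μ ≤ B)
    (hK : ∀ t s, ‖∫ x, e t x * (starRingEnd ℂ) (e s x) ∂ν‖ₑ ≤ k t s) :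
    ∫⁻ t, ‖∫ x, e t x * F x ∂ν‖ₑ ^ 2 ∂μ ≤ 2 * B * ∫⁻ x, ‖F x‖ₑ ^ 2 ∂ν := by
  rcases isEmpty_or_nonempty X with hX | ⟨⟨x0⟩⟩
  · rw [Measure.eq_zero_of_isEmpty ν]; simp
  have hM0 : 0 ≤ M := (norm_nonneg _).trans (hM x0)
  set φ : T → ℂ := fun t => ∫ x, e t x * F x ∂ν with hφ
  have mφ : Measurable φ := by
    have : StronglyMeasurable (Function.uncurry fun t x => e t x * F x) := by
      apply Measurable.stronglyMeasurable
      exact he.mul (hF.comp measurable_snd)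
    exact (this.integral_prod_right).measurable
  set M1 := M * ν.real Set.univ
  have hM1 : 0 ≤ M1 := by positivity
  have bφ : ∀ t, ‖φ t‖ ≤ M1 := by
    intro t
    apply norm_integral_le_of_norm_le_const
    filter_upwards with x
    rw [norm_mul]
    calc _ ≤ 1 * M := by gcongr; exacts [hb t x, hM x]
      _ = M := one_mul M
  have cφ : Measurable fun t => (starRingEnd ℂ) (φ t) := Complex.continuous_conj.measurable.comp mφ
  set H : X → ℂ := fun x => ∫ t, (starRingEnd ℂ) (φ t) * e t x ∂μ with hH
  have mH : Measurable H := by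
    have : StronglyMeasurable (Function.uncurry fun x t => (starRingEnd ℂ) (φ t) * e t x) := by
      apply Measurable.stronglyMeasurable
      exact (cφ.comp measurable_snd).mul (he.comp measurable_swap)
    exact (this.integral_prod_right).measurable
  set M2 := M1 * μ.real Set.univ
  have hM2 : 0 ≤ M2 := by positivity
  have bH : ∀ x, ‖H x‖ ≤ M2 := by
    intro x
    apply norm_integral_le_of_norm_le_const
    filter_upwards with t
    rw [norm_mul, RCLike.norm_conj]
    calc _ ≤ M1 * 1 := by gcongr; exacts [bφ t, hb t x]
      _ = M1 := mul_one M1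
  have cH : Measurable fun t => (starRingEnd ℂ) (H t) := Complex.continuous_conj.measurable.comp mH
  set J := ∫⁻ t, ‖φ t‖ₑ ^ 2 ∂μ with hJ
  set Q := ∫⁻ x, ‖H x‖ₑ ^ 2 ∂ν with hQ
  set N := ∫⁻ x, ‖F x‖ₑ ^ 2 ∂ν with hN
  have Jfin : J ≠ ∞ := by
    rw [hJ, sq_conj μ φ mφ M1 bφ]; simp
  -- first duality
  have s1 : J ≤ ∫⁻ x, ‖H x‖ₑ * ‖F x‖ₑ ∂ν := by
    rw [hJ, sq_conj μ φ mφ M1 bφ]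
    have : ∫ t, φ t * (starRingEnd ℂ) (φ t) ∂μ = ∫ x, H x * F x ∂ν := by
      calc _ = ∫ t, ∫ x, (starRingEnd ℂ) (φ t) * e t x * F x ∂ν ∂μ := by
            congr 1; ext t
            simp_rw [mul_assoc]
            rw [integral_const_mul, mul_comm]
        _ = ∫ x, ∫ t, (starRingEnd ℂ) (φ t) * e t x * F x ∂μ ∂ν := by
            apply swap_bdd μ ν _ _ (M1 * 1 * M)
            · intro t x
              rw [norm_mul, norm_mul, RCLike.norm_conj]
              gcongr
              exacts [bφ t, hb t x, hM x]
            · exact ((cφ.comp measurable_fst).mul he).mul (hF.comp measurable_snd)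
        _ = _ := by
            congr 1; ext x
            rw [integral_mul_const]
    rw [this]
    refine (enorm_integral_le_lintegral_enorm _).trans ?_
    simp_rw [enorm_mul]; exact le_rfl
  have s2 : J ^ 2 ≤ Q * N := by
    have := ENNReal.lintegral_mul_le_Lp_mul_Lq ν (Real.HolderConjugate.two_two) (f := fun x => ‖H x‖ₑ) (g := fun x => ‖F x‖ₑ) mH.enorm.aemeasurable hF.enorm.aemeasurable
    simp only [ENNReal.rpow_two] at this
    have h2 := s1.trans this
    calc J^2 ≤ (Q ^ (1/2:ℝ) * N ^ (1/2:ℝ))^2 := by gcongr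
      _ = Q * N := by
        rw [mul_pow, ← ENNReal.rpow_two, ← ENNReal.rpow_two, ← ENNReal.rpow_mul, ← ENNReal.rpow_mul]
        norm_num
  have s3 : Q ≤ 2 * B * J := by
    rw [hQ, sq_conj ν H mH M2 bH]
    have e1 : ∫ x, H x * (starRingEnd ℂ) (H x) ∂ν = ∫ t, (starRingEnd ℂ) (φ t) * ∫ s, φ s * (∫ x, e t x * (starRingEnd ℂ) (e s x) ∂ν) ∂μ ∂μ := by
      calc _ = ∫ x, ∫ t, (starRingEnd ℂ) (φ t) * e t x * (starRingEnd ℂ) (H x) ∂μ ∂ν := by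
            congr 1; ext x; rw [integral_mul_const]
        _ = ∫ t, ∫ x, (starRingEnd ℂ) (φ t) * e t x * (starRingEnd ℂ) (H x) ∂ν ∂μ := by
            symm
            apply swap_bdd μ ν _ _ (M1 * 1 * M2)
            · intro t x
              rw [norm_mul, norm_mul, RCLike.norm_conj, RCLike.norm_conj]
              gcongr
              exacts [bφ t, hb t x, bH x]
            · exact ((cφ.comp measurable_fst).mul he).mul (cH.comp measurable_snd)
        _ = _ := by
            congr 1; ext t
            simp_rw [mul_assoc]
            rw [integral_const_mul]
            congr 1
            calc _ = ∫ x, ∫ s, φ s * (e t x * (starRingEnd ℂ) (e s x)) ∂μ ∂ν := by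
                  congr 1; ext x
                  rw [hH]; dsimp only
                  rw [← integral_conj, ← integral_const_mul]
                  congr 1; ext s
                  simp; ring
              _ = ∫ s, ∫ x, φ s * (e t x * (starRingEnd ℂ) (e s x)) ∂ν ∂μ := by
                  symm
                  apply swap_bdd μ ν _ _ (M1 * (1 * 1))
                  · intro s x
                    rw [norm_mul, norm_mul, RCLike.norm_conj]
                    gcongr
                    exacts [bφ s, hb t x, hb s x]
                  · apply (mφ.comp measurable_fst).mul
                    apply Measurable.mul
                    · exact he.comp (measurable_const.prodMk measurable_snd)
                    · exact Complex.continuous_conj.measurable.comp he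
              _ = _ := by
                  congr 1; ext s; rw [integral_const_mul]
    rw [e1]
    have mk1 : ∀ t, Measurable fun s => k t s := fun t => hk.comp (measurable_const.prodMk measurable_id)
    calc _ ≤ ∫⁻ t, ‖φ t‖ₑ * ∫⁻ s, ‖φ s‖ₑ * k t s ∂μ ∂μ := by
          refine (enorm_integral_le_lintegral_enorm _).trans ?_
          apply lintegral_mono; intro t
          dsimp only
          rw [enorm_mul, RCLike.enorm_conj]
          gcongr
          refine (enorm_integral_le_lintegral_enorm _).trans ?_
          apply lintegral_mono; intro s
          dsimp only
          rw [enorm_mul]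
          gcongr
          exact hK t s
      _ = ∫⁻ t, ∫⁻ s, ‖φ t‖ₑ * (‖φ s‖ₑ * k t s) ∂μ ∂μ := by
          congr 1; ext t
          rw [lintegral_const_mul' _ _ (by simp)]
      _ ≤ ∫⁻ t, ∫⁻ s, (‖φ t‖ₑ^2 * k t s + ‖φ s‖ₑ^2 * k t s) ∂μ ∂μ := by
          apply lintegral_mono; intro t
          apply lintegral_mono; intro s
          dsimp only
          rw [← mul_assoc, ← add_mul]
          gcongr
          rcases le_total ‖φ t‖ₑ ‖φ s‖ₑ with h | h
          · calc _ ≤ ‖φ s‖ₑ * ‖φ s‖ₑ := by gcongr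
              _ = ‖φ s‖ₑ^2 := by ring
              _ ≤ _ := le_add_self
          · calc _ ≤ ‖φ t‖ₑ * ‖φ t‖ₑ := by gcongr
              _ = ‖φ t‖ₑ^2 := by ring
              _ ≤ _ := le_self_add
      _ = ∫⁻ t, ∫⁻ s, ‖φ t‖ₑ^2 * k t s ∂μ ∂μ + ∫⁻ t, ∫⁻ s, ‖φ s‖ₑ^2 * k t s ∂μ ∂μ := by
          rw [← lintegral_add_left]
          · congr 1; ext t
            rw [lintegral_add_left]
            exact (mk1 t).const_mul _
          · apply Measurable.lintegral_prod_right'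
              (f := fun z : T × T => ‖φ z.1‖ₑ^2 * k z.1 z.2)
            exact ((mφ.enorm.pow_const 2).comp measurable_fst).mul hk
      _ = ∫⁻ t, ∫⁻ s, ‖φ t‖ₑ^2 * k t s ∂μ ∂μ + ∫⁻ s, ∫⁻ t, ‖φ s‖ₑ^2 * k t s ∂μ ∂μ := by
          congr 1
          apply lintegral_lintegral_swap
          exact (((mφ.enorm.pow_const 2).comp measurable_snd).mul hk).aemeasurable
      _ = 2 * ∫⁻ t, ‖φ t‖ₑ^2 * ∫⁻ s, k t s ∂μ ∂μ := by
          rw [two_mul]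
          congr 1
          · congr 1; ext t; rw [lintegral_const_mul' _ _ (by simp)]
          · congr 1; ext t; rw [lintegral_const_mul' _ _ (by simp)]
            simp_rw [hsym]
      _ ≤ 2 * ∫⁻ t, ‖φ t‖ₑ^2 * B ∂μ := by
          gcongr with t
          exact hB t
      _ = _ := by
          rw [lintegral_mul_const _ (mφ.enorm.pow_const 2)]; ring
  rcases eq_or_ne J 0 with h0 | h0
  · rw [h0]; exact zero_le
  have : J * J ≤ J * (2 * B * N) := by
    calc J * J = J^2 := by ring
      _ ≤ Q * N := s2
      _ ≤ 2 * B * J * N := by gcongr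
      _ = _ := by ring
  exact (ENNReal.mul_le_mul_iff_right h0 Jfin).1 this

noncomputable def gw (α l r : ℝ) : ℝ := max (r ^ α - (l / 2) ^ α) 0

noncomputable def ee (κ α A l t : ℝ) (x ξ : Plane) : ℂ :=
  Complex.exp (Complex.I * (2 * Real.pi * inner ℝ ξ x - A * t * (ξ 0 / ‖ξ‖) : ℝ)) *
    (Real.exp (-(κ * max t 0 * gw α l ‖ξ‖)) : ℝ)

theorem gw_nonneg (α l r : ℝ) : 0 ≤ gw α l r := le_max_right _ _

theorem gw_meas (α l : ℝ) : Measurable (gw α l) := by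
  unfold gw; fun_prop

theorem ew_le {κ : ℝ} (hκ : 0 < κ) (α l t r : ℝ) : Real.exp (-(κ * max t 0 * gw α l r)) ≤ 1 := by
  rw [Real.exp_le_one_iff]
  have := gw_nonneg α l r
  have h2 : 0 ≤ max t 0 := le_max_right _ _
  have : 0 ≤ κ * max t 0 * gw α l r := by positivity
  linarith

theorem ee_le {κ : ℝ} (hκ : 0 < κ) (α A l t : ℝ) (x ξ : Plane) : ‖ee κ α A l t x ξ‖ ≤ 1 := by
  rw [ee, norm_mul, mul_comm Complex.I, Complex.norm_exp_ofReal_mul_I, one_mul, Complex.norm_real,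
    Real.norm_eq_abs, abs_of_pos (Real.exp_pos _)]
  exact ew_le hκ _ _ _ _

theorem ee_meas (κ α A l : ℝ) (X : ℝ → Plane) (hX : Measurable X) :
    Measurable (Function.uncurry fun t ξ => ee κ α A l t (X t) ξ) := by
  have hg := gw_meas α l
  have h0 : Measurable fun ξ : Plane => ξ 0 := by fun_prop
  have hi : Measurable fun z : ℝ × Plane => inner ℝ z.2 (X z.1) :=
    measurable_snd.inner (hX.comp measurable_fst)
  unfold ee Function.uncurry
  apply Measurable.mul
  · apply Complex.measurable_exp.comp
    apply Measurable.const_mul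
    apply Complex.measurable_ofReal.comp
    apply Measurable.sub
    · exact hi.const_mul _
    · exact (measurable_fst.const_mul A).mul ((h0.div measurable_norm).comp measurable_snd)
  · apply Complex.measurable_ofReal.comp
    apply Real.measurable_exp.comp
    apply Measurable.neg
    exact ((measurable_fst.max measurable_const).const_mul κ).mul ((hg.comp measurable_norm).comp measurable_snd)

instance ann_fin (l : ℝ) : IsFiniteMeasure (volume.restrict (ann l)) := by
  constructor
  rw [Measure.restrict_apply_univ]
  refine lt_of_le_of_lt (measure_mono (t := Metric.closedBall 0 (2*l)) ?_) measure_closedBall_lt_top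
  intro ξ h; simpa using h.2

noncomputable def VV (κ α A l : ℝ) (F : Plane → ℂ) (t : ℝ) (x : Plane) : ℂ :=
  ∫ ξ in ann l, ee κ α A l t x ξ * F ξ

theorem max1 {κ : ℝ} (hκ : 0 < κ) (α A : ℝ) {l : ℝ} (hA : A ≠ 0) (hl : 0 < l) (X : ℝ → Plane) (hX : Measurable X)
    (F : Plane → ℂ) (hF : Measurable F) (M : ℝ) (hM : ∀ x, ‖F x‖ ≤ M) (μ : Measure ℝ) [IsFiniteMeasure μ]
    (hμ : μ ≤ volume) (L : ℝ) (hL : 0 < L) (hm : μ Set.univ ≤ ENNReal.ofReal L) :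
    ∫⁻ t, ‖VV κ α A l F t (X t)‖ₑ ^ 2 ∂μ ≤
      2 * (ENNReal.ofReal (600 * l^2) * ENNReal.ofReal |A| ^ (-(1/2) : ℝ) * ENNReal.ofReal (5 * √L)) *
        ∫⁻ ξ in ann l, ‖F ξ‖ₑ ^ 2 := by
  have hA' : ENNReal.ofReal |A| ≠ 0 := by simpa using hA
  have hk : Measurable (Function.uncurry fun t s : ℝ => ENNReal.ofReal (600 * l^2) * ENNReal.ofReal |A * (t - s)| ^ (-(1/2) : ℝ)) := by
    unfold Function.uncurry
    fun_prop
  refine ttstar μ (volume.restrict (ann l)) (fun t ξ => ee κ α A l t (X t) ξ) (ee_meas κ α A l X hX)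
    (fun t ξ => ee_le hκ α A l t (X t) ξ) F hF M hM _ hk ?_ _ ?_ ?_
  · intro t s
    rw [show A * (t - s) = - (A * (s - t)) by ring, abs_neg]
  · intro t
    have : ∀ s, ENNReal.ofReal (600 * l^2) * ENNReal.ofReal |A * (t - s)| ^ (-(1/2) : ℝ) =
        ENNReal.ofReal (600 * l^2) * ENNReal.ofReal |A| ^ (-(1/2) : ℝ) * ENNReal.ofReal |s - t| ^ (-(1/2) : ℝ) := by
      intro s
      rw [abs_mul, abs_sub_comm, ENNReal.ofReal_mul (abs_nonneg A), ENNReal.mul_rpow_of_ne_top (by simp) (by simp), mul_assoc]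
    simp_rw [this]
    rw [lintegral_const_mul']
    · gcongr
      exact sing_meas μ hμ L t hL hm
    · apply ENNReal.mul_ne_top ENNReal.ofReal_ne_top
      simp [ENNReal.rpow_eq_top_iff, hA]
  · intro t s
    have e : ∀ ξ, ee κ α A l t (X t) ξ * (starRingEnd ℂ) (ee κ α A l s (X s) ξ) =
        Complex.exp (Complex.I * (2 * Real.pi * inner ℝ ξ (X t - X s) - (A * (t - s)) * (ξ 0 / ‖ξ‖) : ℝ)) *
          ((fun r => Real.exp (-(κ * max t 0 * gw α l r)) * Real.exp (-(κ * max s 0 * gw α l r))) ‖ξ‖ : ℝ) := by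
      intro ξ
      unfold ee
      rw [map_mul, ← Complex.exp_conj, map_mul, Complex.conj_ofReal, Complex.conj_I, Complex.conj_ofReal, inner_sub_right]
      have : ∀ a b c d : ℂ, a * b * (c * d) = (a * c) * (b * d) := by intros; ring
      rw [this, ← Complex.exp_add]
      congr 1
      · congr 1; push_cast; ring
      · push_cast; rfl
    simp_rw [e]
    apply ker_bound l hl (A * (t - s)) (X t - X s)
      (fun r => Real.exp (-(κ * max t 0 * gw α l r)) * Real.exp (-(κ * max s 0 * gw α l r)))
    intro r _ _
    rw [abs_of_pos (by positivity)]
    calc _ ≤ (1:ℝ) * 1 := by gcongr <;> exact ew_le hκ _ _ _ _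
      _ = 1 := one_mul 1

theorem VV_meas (κ α A l : ℝ) (F : Plane → ℂ) (hF : Measurable F) (X : ℝ → Plane) (hX : Measurable X) :
    Measurable fun t => VV κ α A l F t (X t) := by
  have : StronglyMeasurable (Function.uncurry fun t ξ => ee κ α A l t (X t) ξ * F ξ) := by
    apply Measurable.stronglyMeasurable
    exact (ee_meas κ α A l X hX).mul (hF.comp measurable_snd)
  exact (this.integral_prod_right).measurable

theorem VV_cont {κ : ℝ} (hκ : 0 < κ) (α A l : ℝ) (F : Plane → ℂ) (hF : Measurable F)
    (M : ℝ) (hM : ∀ x, ‖F x‖ ≤ M) (t : ℝ) :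
    Continuous fun x => VV κ α A l F t x := by
  unfold VV
  apply continuous_of_dominated (bound := fun _ => M)
  · intro x
    have := (ee_meas κ α A l (fun _ => x) measurable_const).comp (measurable_const.prodMk measurable_id : Measurable fun ξ : Plane => (t, ξ))
    exact (this.mul hF).aestronglyMeasurable
  · intro x
    filter_upwards with ξ
    rw [norm_mul]
    calc _ ≤ 1 * M := by gcongr; exacts [ee_le hκ _ _ _ _ _ _, hM ξ]
      _ = M := one_mul M
  · exact integrable_const M
  · filter_upwards with ξ
    unfold ee
    fun_prop

noncomputable def SS (κ α A l : ℝ) (F : Plane → ℂ) (t : ℝ) : ℝ≥0∞ :=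
  ⨆ n : ℕ, ‖VV κ α A l F t (TopologicalSpace.denseSeq Plane n)‖ₑ

theorem SS_meas (κ α A l : ℝ) (F : Plane → ℂ) (hF : Measurable F) : Measurable (SS κ α A l F) := by
  unfold SS
  apply Measurable.iSup
  intro n
  exact (VV_meas κ α A l F hF _ measurable_const).enorm

theorem VV_le_SS {κ : ℝ} (hκ : 0 < κ) (α A l : ℝ) (F : Plane → ℂ) (hF : Measurable F)
    (M : ℝ) (hM : ∀ x, ‖F x‖ ≤ M) (t : ℝ) (x : Plane) : ‖VV κ α A l F t x‖ₑ ≤ SS κ α A l F t := by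
  apply (TopologicalSpace.denseRange_denseSeq Plane).induction_on (p := fun x => ‖VV κ α A l F t x‖ₑ ≤ SS κ α A l F t) x
  · exact isClosed_le (VV_cont hκ α A l F hF M hM t).enorm continuous_const
  · intro n
    exact le_iSup (fun n : ℕ => ‖VV κ α A l F t (TopologicalSpace.denseSeq Plane n)‖ₑ) n

noncomputable def sel (κ α A l : ℝ) (F : Plane → ℂ) : ℕ → ℝ → Plane
  | 0 => fun _ => TopologicalSpace.denseSeq Plane 0
  | n + 1 => fun t => by
      classical
      exact if ‖VV κ α A l F t (sel κ α A l F n t)‖ₑ < ‖VV κ α A l F t (TopologicalSpace.denseSeq Plane (n+1))‖ₑ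
        then TopologicalSpace.denseSeq Plane (n+1) else sel κ α A l F n t

theorem sel_meas (κ α A l : ℝ) (F : Plane → ℂ) (hF : Measurable F) (n : ℕ) : Measurable (sel κ α A l F n) := by
  induction n with
  | zero => exact measurable_const
  | succ n ih =>
    unfold sel
    apply Measurable.ite _ measurable_const ih
    exact measurableSet_lt (VV_meas κ α A l F hF _ ih).enorm (VV_meas κ α A l F hF _ measurable_const).enorm

theorem sel_mono (κ α A l : ℝ) (F : Plane → ℂ) (t : ℝ) (n : ℕ) :
    ‖VV κ α A l F t (sel κ α A l F n t)‖ₑ ≤ ‖VV κ α A l F t (sel κ α A l F (n+1) t)‖ₑ := by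
  conv_rhs => unfold sel
  split_ifs with h
  · exact h.le
  · exact le_rfl

theorem sel_ge (κ α A l : ℝ) (F : Plane → ℂ) (t : ℝ) (n : ℕ) :
    ‖VV κ α A l F t (TopologicalSpace.denseSeq Plane n)‖ₑ ≤ ‖VV κ α A l F t (sel κ α A l F n t)‖ₑ := by
  cases n with
  | zero => exact le_rfl
  | succ n =>
    conv_rhs => unfold sel
    split_ifs with h
    · exact le_rfl
    · exact not_lt.1 h

theorem max2 {κ : ℝ} (hκ : 0 < κ) (α A : ℝ) {l : ℝ} (hA : A ≠ 0) (hl : 0 < l)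
    (F : Plane → ℂ) (hF : Measurable F) (M : ℝ) (hM : ∀ x, ‖F x‖ ≤ M) (μ : Measure ℝ) [IsFiniteMeasure μ]
    (hμ : μ ≤ volume) (L : ℝ) (hL : 0 < L) (hm : μ Set.univ ≤ ENNReal.ofReal L) :
    ∫⁻ t, SS κ α A l F t ^ 2 ∂μ ≤
      2 * (ENNReal.ofReal (600 * l^2) * ENNReal.ofReal |A| ^ (-(1/2) : ℝ) * ENNReal.ofReal (5 * √L)) *
        ∫⁻ ξ in ann l, ‖F ξ‖ₑ ^ 2 := by
  calc _ ≤ ∫⁻ t, ⨆ n : ℕ, ‖VV κ α A l F t (sel κ α A l F n t)‖ₑ ^ 2 ∂μ := by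
        apply lintegral_mono; intro t
        dsimp only
        rw [SS, ENNReal.iSup_pow]
        apply iSup_mono; intro n
        gcongr
        exact sel_ge κ α A l F t n
    _ = ⨆ n : ℕ, ∫⁻ t, ‖VV κ α A l F t (sel κ α A l F n t)‖ₑ ^ 2 ∂μ := by
        apply lintegral_iSup
        · intro n
          exact (VV_meas κ α A l F hF _ (sel_meas κ α A l F hF n)).enorm.pow_const 2
        · apply monotone_nat_of_le_succ
          intro n t
          dsimp only
          gcongr
          exact sel_mono κ α A l F t n
    _ ≤ _ := by
        apply iSup_le; intro n
        exact max1 hκ α A hA hl _ (sel_meas κ α A l F hF n) F hF M hM μ hμ L hL hm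

/-- large frequency case -/
theorem real_a (α δ ρ κ a l : ℝ) (hα : 0 < α) (hκ : 0 < κ) (ha : 0 < a) (hl : 0 < l) (hρ : 0 < ρ)
    (h1 : 1 / α * δ ≤ 1 / ρ) (hc : a ≤ κ * l ^ α) :
    (4 * l) ^ δ * (1 / (ρ * (κ * (l/2)^α))) ^ (1/ρ) ≤
      (4 ^ δ * (ρ * 2⁻¹ ^ α) ^ (-(1/ρ))) * κ ^ (-(1/α) * δ) * a ^ (1/α * δ - 1/ρ) := by
  have hy : 0 < κ * l ^ α := by positivity
  have hll : l ^ δ = (κ * l^α) ^ (1/α*δ) * κ ^ (-(1/α)*δ) := by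
    rw [Real.mul_rpow hκ.le (by positivity), ← Real.rpow_mul hl.le, mul_right_comm, ← Real.rpow_add hκ]
    rw [show 1/α*δ + -(1/α)*δ = 0 by ring, Real.rpow_zero, one_mul]
    congr 1; field_simp
  have hb : ρ * (κ * (l/2)^α) = (ρ * 2⁻¹^α) * (κ * l^α) := by
    rw [div_eq_mul_inv, Real.mul_rpow hl.le (by norm_num)]; ring
  rw [hb, one_div (_ * _), Real.inv_rpow (by positivity), ← Real.rpow_neg (by positivity),
    Real.mul_rpow (by norm_num) hl.le, hll, Real.mul_rpow (by positivity) hy.le]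
  have : (κ * l^α) ^ (1/α*δ - 1/ρ) ≤ a ^ (1/α * δ - 1/ρ) :=
    Real.rpow_le_rpow_of_nonpos ha hc (by linarith)
  calc _ = (4 ^ δ * (ρ * 2⁻¹ ^ α) ^ (-(1/ρ))) * κ ^ (-(1/α) * δ) * ((κ * l^α) ^ (1/α*δ) * (κ * l^α)^(-(1/ρ))) := by ring
    _ = (4 ^ δ * (ρ * 2⁻¹ ^ α) ^ (-(1/ρ))) * κ ^ (-(1/α) * δ) * ((κ * l^α) ^ (1/α*δ - 1/ρ)) := by
        rw [← Real.rpow_add hy]; rfl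
    _ ≤ _ := by gcongr

/-- small frequency case -/
theorem real_b (α δ ρ κ a l : ℝ) (hα : 0 < α) (hκ : 0 < κ) (ha : 0 < a) (hl : 0 < l) (hρ : 0 < ρ)
    (h1 : 1 / ρ < (1 / α + 1/4) * δ) (hc : κ * l ^ α ≤ a) :
    (6000 * l^2 * a ^ (-(1/2) : ℝ) * √(1 / (ρ * (κ * (l/2)^α)))) ^ (δ/2) * (1 / (ρ * (κ * (l/2)^α))) ^ (1/ρ - δ/2) ≤
      (6000 ^ (δ/2) * (ρ * 2⁻¹ ^ α) ^ (δ/4 - 1/ρ)) * κ ^ (-(1/α) * δ) * a ^ (1/α * δ - 1/ρ) := by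
  have hy : 0 < κ * l ^ α := by positivity
  have hll : l ^ δ = (κ * l^α) ^ (1/α*δ) * κ ^ (-(1/α)*δ) := by
    rw [Real.mul_rpow hκ.le (by positivity), ← Real.rpow_mul hl.le, mul_right_comm, ← Real.rpow_add hκ]
    rw [show 1/α*δ + -(1/α)*δ = 0 by ring, Real.rpow_zero, one_mul]
    congr 1; field_simp
  have hb : ρ * (κ * (l/2)^α) = (ρ * 2⁻¹^α) * (κ * l^α) := by
    rw [div_eq_mul_inv, Real.mul_rpow hl.le (by norm_num)]; ring
  rw [hb]
  set c0 := ρ * 2⁻¹^α with hc0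
  set y := κ * l^α with hyd
  have c0p : 0 < c0 := by positivity
  have hby : 0 < c0 * y := by positivity
  have e1 : √(1 / (c0 * y)) = (c0 * y) ^ (-(1/2) : ℝ) := by
    rw [Real.sqrt_eq_rpow, one_div (c0 * y), Real.inv_rpow hby.le, Real.rpow_neg hby.le]
  have e2 : (1 / (c0 * y)) ^ (1/ρ - δ/2) = (c0 * y) ^ (δ/2 - 1/ρ) := by
    rw [one_div (c0 * y), Real.inv_rpow hby.le, ← Real.rpow_neg hby.le]; congr 1; ring
  rw [e1, e2, Real.mul_rpow (by positivity) (by positivity), Real.mul_rpow (by positivity) (by positivity),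
    Real.mul_rpow (by positivity) (by positivity), ← Real.rpow_mul hby.le, ← Real.rpow_mul ha.le,
    ← Real.rpow_natCast l 2, ← Real.rpow_mul hl.le]
  have e3 : ((2:ℕ):ℝ) * (δ/2) = δ := by push_cast; ring
  rw [e3, hll]
  have : y ^ (1/α*δ + δ/4 - 1/ρ) ≤ a ^ (1/α*δ + δ/4 - 1/ρ) :=
    Real.rpow_le_rpow hy.le hc (by linarith)
  calc _ = 6000 ^ (δ/2) * κ ^ (-(1/α) * δ) * y ^ (1/α*δ) * a ^ (-(1/2) * (δ/2)) * ((c0 * y) ^ (-(1/2) * (δ/2)) * (c0 * y) ^ (δ/2 - 1/ρ)) := by ring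
    _ = 6000 ^ (δ/2) * κ ^ (-(1/α) * δ) * y ^ (1/α*δ) * a ^ (-(1/2) * (δ/2)) * (c0 ^ (δ/4 - 1/ρ) * y ^ (δ/4 - 1/ρ)) := by
        rw [← Real.rpow_add hby, ← Real.mul_rpow c0p.le hy.le]; congr 2; ring
    _ = 6000 ^ (δ/2) * c0 ^ (δ/4 - 1/ρ) * κ ^ (-(1/α) * δ) * (y ^ (1/α*δ) * y ^ (δ/4 - 1/ρ)) * a ^ (-(1/2) * (δ/2)) := by ring
    _ = 6000 ^ (δ/2) * c0 ^ (δ/4 - 1/ρ) * κ ^ (-(1/α) * δ) * y ^ (1/α*δ + δ/4 - 1/ρ) * a ^ (-(1/2) * (δ/2)) := by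
        rw [← Real.rpow_add hy]; congr 3; ring
    _ ≤ 6000 ^ (δ/2) * c0 ^ (δ/4 - 1/ρ) * κ ^ (-(1/α) * δ) * a ^ (1/α*δ + δ/4 - 1/ρ) * a ^ (-(1/2) * (δ/2)) := by gcongr
    _ = _ := by
        rw [mul_assoc, ← Real.rpow_add ha]; congr 2; ring

noncomputable def UU (κ α A : ℝ) (F : Plane → ℂ) (t : ℝ) : Plane → ℂ :=
  𝓕⁻ (fun ξ => hsym κ α t ξ * dsym A t ξ * F ξ)

theorem UU_eq (κ α A l : ℝ) (hα : 0 < α) (hl : 0 < l) (F : Plane → ℂ) (hs : ∀ ξ, F ξ ≠ 0 → ξ ∈ ann l)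
    (t : ℝ) (ht : 0 < t) (x : Plane) :
    UU κ α A F t x = (Real.exp (-(κ * t * (l/2)^α)) : ℝ) * VV κ α A l F t x := by
  rw [UU, Real.fourierInv_eq', VV, ← integral_const_mul, ← integral_indicator (ann_meas l)]
  congr 1; ext ξ
  by_cases h : ξ ∈ ann l
  · rw [Set.indicator_of_mem h]
    have hg : gw α l ‖ξ‖ = ‖ξ‖^α - (l/2)^α := by
      rw [gw, max_eq_left]
      rw [sub_nonneg]
      exact Real.rpow_le_rpow (by positivity) h.1 hα.le
    rw [ee, hg, max_eq_left ht.le, hsym, dsym, smul_eq_mul]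
    have e1 : Real.exp (-(κ * t * ‖ξ‖^α)) = Real.exp (-(κ * t * (l/2)^α)) * Real.exp (-(κ * t * (‖ξ‖^α - (l/2)^α))) := by
      rw [← Real.exp_add]; congr 1; ring
    have e2 : Complex.exp (Complex.I * (2 * Real.pi * inner ℝ ξ x - A * t * (ξ 0 / ‖ξ‖) : ℝ)) =
        Complex.exp ((2 * Real.pi * inner ℝ ξ x : ℝ) * Complex.I) * Complex.exp (-(A * t) * Complex.I * (ξ 0 : ℝ) / (‖ξ‖ : ℝ)) := by
      rw [← Complex.exp_add]; congr 1; push_cast; ring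
    rw [e1, e2]; push_cast; ring
  · rw [Set.indicator_of_notMem h]
    have : F ξ = 0 := by by_contra hh; exact h (hs ξ hh)
    simp [this]

theorem dsym_norm (A t : ℝ) (ξ : Plane) : ‖dsym A t ξ‖ = 1 := by
  have : -(A * t) * Complex.I * (ξ 0 : ℝ) / (‖ξ‖ : ℝ) = ((-(A*t) * ξ 0 / ‖ξ‖ : ℝ) : ℂ) * Complex.I := by
    push_cast; ring
  rw [dsym, this, Complex.norm_exp_ofReal_mul_I]

theorem dsym_meas (A t : ℝ) : Measurable (dsym A t) := by
  have h0 : Measurable fun ξ : Plane => ξ 0 := by fun_prop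
  unfold dsym
  apply Complex.measurable_exp.comp
  apply Measurable.div
  · exact (Complex.measurable_ofReal.comp h0).const_mul _
  · exact Complex.measurable_ofReal.comp measurable_norm

theorem supp_good (l : ℝ) (F : Plane → ℂ) (hF : Measurable F) (M : ℝ) (hM : ∀ x, ‖F x‖ ≤ M)
    (hs : ∀ ξ, F ξ ≠ 0 → ξ ∈ ann l) (p : ℝ≥0∞) : MemLp F p volume := by
  have e : F = (ann l).indicator F := by
    ext ξ
    by_cases h : ξ ∈ ann l
    · rw [Set.indicator_of_mem h]
    · rw [Set.indicator_of_notMem h]; by_contra hh; exact h (hs ξ hh)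
  rw [e, memLp_indicator_iff_restrict (ann_meas l)]
  exact MemLp.of_bound hF.aestronglyMeasurable M (by filter_upwards with x using hM x)

theorem UU_two (κ α A l : ℝ) (hκ : 0 < κ) (hα : 0 < α) (hl : 0 < l) (F : Plane → ℂ) (hF : Measurable F) (M : ℝ) (hM : ∀ x, ‖F x‖ ≤ M)
    (hs : ∀ ξ, F ξ ≠ 0 → ξ ∈ ann l) (t : ℝ) (ht : 0 < t) :
    eLpNorm (UU κ α A F t) 2 volume ≤ ENNReal.ofReal (Real.exp (-(κ * t * (l/2)^α))) * eLpNorm F 2 volume := by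
  have hn : ∀ ξ, ‖hsym κ α t ξ * dsym A t ξ * F ξ‖ ≤ Real.exp (-(κ * t * (l/2)^α)) * ‖F ξ‖ := by
    intro ξ
    by_cases h : F ξ = 0
    · simp [h]
    · have := (hs ξ h).1
      rw [norm_mul, norm_mul, dsym_norm, mul_one, hsym, Complex.norm_real, Real.norm_eq_abs, abs_of_pos (Real.exp_pos _)]
      gcongr
  have hn2 : ∀ ξ, ‖hsym κ α t ξ * dsym A t ξ * F ξ‖ ≤ M := by
    intro ξ
    refine (hn ξ).trans ?_
    have : Real.exp (-(κ * t * (l/2)^α)) ≤ 1 := by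
      rw [Real.exp_le_one_iff]
      have : 0 ≤ κ * t * (l/2)^α := by positivity
      linarith
    calc _ ≤ 1 * ‖F ξ‖ := by gcongr
      _ = ‖F ξ‖ := one_mul _
      _ ≤ M := hM ξ
  have hm : Measurable fun ξ => hsym κ α t ξ * dsym A t ξ * F ξ :=
    ((hsym_cont κ α t hα).measurable.mul (dsym_meas A t)).mul hF
  have hs' : ∀ ξ, hsym κ α t ξ * dsym A t ξ * F ξ ≠ 0 → ξ ∈ ann l := fun ξ h => hs ξ (right_ne_zero_of_mul h)
  have g := supp_good l _ hm M hn2 hs'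
  rw [UU, plancherel_inv _ (memLp_one_iff_integrable.1 (g 1)) (g 2)]
  apply eLpNorm_le_mul_eLpNorm_of_ae_le_mul
  filter_upwards with ξ using hn ξ

theorem interp (u : Plane → ℂ) (p : ℝ) (hp : 2 < p) (D : ℝ≥0∞) (hD : D ≠ ∞) (hu : ∀ x, ‖u x‖ₑ ≤ D) :
    eLpNorm u (ENNReal.ofReal p) volume ≤ D ^ (1 - 2/p) * (eLpNorm u 2 volume) ^ (2/p) := by
  have hp0 : 0 < p := by linarith
  rw [eLpNorm_eq_lintegral_rpow_enorm_toReal (by simpa using hp0) (by simp),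
    eLpNorm_eq_lintegral_rpow_enorm_toReal (by simp) (by simp), ENNReal.toReal_ofReal hp0.le]
  have h2 : (2:ℝ≥0∞).toReal = 2 := by simp
  rw [h2, ← ENNReal.rpow_mul]
  have : ∫⁻ x, ‖u x‖ₑ ^ p ≤ D ^ (p - 2) * ∫⁻ x, ‖u x‖ₑ ^ (2:ℝ) := by
    rw [← lintegral_const_mul' _ _ (ENNReal.rpow_ne_top_of_nonneg (by linarith) hD)]
    apply lintegral_mono; intro x
    dsimp only
    calc ‖u x‖ₑ ^ p = ‖u x‖ₑ ^ (p - 2) * ‖u x‖ₑ ^ (2:ℝ) := by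
          rw [← ENNReal.rpow_add_of_nonneg _ _ (by linarith) (by norm_num)]; congr 1; ring
      _ ≤ _ := by gcongr; exact hu x
  calc _ ≤ (D ^ (p - 2) * ∫⁻ x, ‖u x‖ₑ ^ (2:ℝ)) ^ (1/p) := by gcongr
    _ = _ := by
      rw [ENNReal.mul_rpow_of_nonneg _ _ (by positivity), ← ENNReal.rpow_mul]
      congr 2 <;> field_simp

theorem N_eq (l : ℝ) (F : Plane → ℂ) (hs : ∀ ξ, F ξ ≠ 0 → ξ ∈ ann l) :
    ∫⁻ ξ in ann l, ‖F ξ‖ₑ ^ 2 = eLpNorm F 2 volume ^ 2 := by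
  rw [eLpNorm_eq_lintegral_rpow_enorm_toReal (by simp) (by simp), ← ENNReal.rpow_natCast, ← ENNReal.rpow_mul]
  simp only [ENNReal.toReal_ofNat, Nat.cast_ofNat, one_div, ne_eq, OfNat.ofNat_ne_zero, not_false_eq_true,
    inv_mul_cancel₀, ENNReal.rpow_one, ENNReal.rpow_two]
  rw [← lintegral_indicator (ann_meas l)]
  congr 1; ext ξ
  by_cases h : ξ ∈ ann l
  · rw [Set.indicator_of_mem h]
  · rw [Set.indicator_of_notMem h]
    have : F ξ = 0 := by by_contra hh; exact h (hs ξ hh)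
    simp [this]

theorem SS_le (κ α A l : ℝ) (hκ : 0 < κ) (hl : 0 < l) (F : Plane → ℂ) (hF : Measurable F)
    (hs : ∀ ξ, F ξ ≠ 0 → ξ ∈ ann l) (t : ℝ) :
    SS κ α A l F t ≤ ENNReal.ofReal (4 * l) * eLpNorm F 2 volume := by
  apply iSup_le; intro n
  have hvol : volume (ann l) ≤ ENNReal.ofReal (4 * l) ^ 2 := by
    calc _ ≤ volume (Metric.closedBall (0:Plane) (2*l)) := by
          apply measure_mono; intro ξ h; simpa using h.2
      _ = ENNReal.ofReal ((2*l)^2 * Real.pi) := by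
          rw [EuclideanSpace.volume_closedBall_fin_two, ← ENNReal.ofReal_pow (by positivity), ← ENNReal.ofReal_mul (by positivity)]
      _ ≤ ENNReal.ofReal ((4*l)^2) := by
          apply ENNReal.ofReal_le_ofReal
          nlinarith [Real.pi_le_four, sq_nonneg l]
      _ = _ := ENNReal.ofReal_pow (by positivity) _
  calc _ ≤ ∫⁻ ξ in ann l, 1 * ‖F ξ‖ₑ := by
        refine (enorm_integral_le_lintegral_enorm _).trans ?_
        apply lintegral_mono; intro ξ
        dsimp only
        rw [enorm_mul]
        gcongr
        rw [← ofReal_norm, ← ENNReal.ofReal_one]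
        exact ENNReal.ofReal_le_ofReal (ee_le hκ _ _ _ _ _ _)
    _ ≤ (∫⁻ ξ in ann l, 1 ^ (2:ℝ)) ^ (1/2:ℝ) * (∫⁻ ξ in ann l, ‖F ξ‖ₑ ^ (2:ℝ)) ^ (1/2:ℝ) :=
        ENNReal.lintegral_mul_le_Lp_mul_Lq _ (Real.HolderConjugate.two_two) measurable_const.aemeasurable hF.enorm.aemeasurable
    _ ≤ (ENNReal.ofReal (4*l)^2) ^ (1/2:ℝ) * (eLpNorm F 2 volume ^ 2) ^ (1/2:ℝ) := by
        gcongr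
        · simpa using hvol
        · simp only [ENNReal.rpow_two]
          exact (N_eq l F hs).le
    _ = _ := by
        rw [← ENNReal.rpow_natCast, ← ENNReal.rpow_natCast, ← ENNReal.rpow_mul, ← ENNReal.rpow_mul]
        norm_num

theorem UU_p (κ α A l p : ℝ) (hp : 2 < p) (hκ : 0 < κ) (hα : 0 < α) (hl : 0 < l) (F : Plane → ℂ) (hF : Measurable F) (M : ℝ) (hM : ∀ x, ‖F x‖ ≤ M)
    (hs : ∀ ξ, F ξ ≠ 0 → ξ ∈ ann l) (t : ℝ) (ht : 0 < t) :
    eLpNorm (UU κ α A F t) (ENNReal.ofReal p) volume ≤ ENNReal.ofReal (Real.exp (-(κ * t * (l/2)^α))) *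
      (SS κ α A l F t ^ (1 - 2/p) * eLpNorm F 2 volume ^ (2/p)) := by
  set E := ENNReal.ofReal (Real.exp (-(κ * t * (l/2)^α))) with hE
  have hp0 : 0 < p := by linarith
  have hd : 0 ≤ 1 - 2/p := by rw [sub_nonneg, div_le_one hp0]; exact hp.le
  have hN : eLpNorm F 2 volume ≠ ∞ := (supp_good l F hF M hM hs 2).2.ne
  have hS : SS κ α A l F t ≠ ∞ :=
    ((SS_le κ α A l hκ hl F hF hs t).trans_lt (ENNReal.mul_lt_top ENNReal.ofReal_lt_top hN.lt_top)).ne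
  have h1 := interp (UU κ α A F t) p hp (E * SS κ α A l F t) (ENNReal.mul_ne_top ENNReal.ofReal_ne_top hS) (by
    intro x
    rw [UU_eq κ α A l hα hl F hs t ht, enorm_mul, ← ofReal_norm, Complex.norm_real, Real.norm_eq_abs, abs_of_pos (Real.exp_pos _)]
    gcongr
    exact VV_le_SS hκ α A l F hF M hM t x)
  calc _ ≤ _ := h1
    _ ≤ (E * SS κ α A l F t) ^ (1 - 2/p) * (E * eLpNorm F 2 volume) ^ (2/p) := by
        gcongr
        exact UU_two κ α A l hκ hα hl F hF M hM hs t ht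
    _ = (E ^ (1 - 2/p) * E ^ (2/p)) * (SS κ α A l F t ^ (1 - 2/p) * eLpNorm F 2 volume ^ (2/p)) := by
        rw [ENNReal.mul_rpow_of_nonneg _ _ hd, ENNReal.mul_rpow_of_nonneg _ _ (by positivity)]; ring
    _ = _ := by
        rw [← ENNReal.rpow_add_of_nonneg _ _ hd (by positivity), sub_add_cancel, ENNReal.rpow_one]

noncomputable def mmu (b : ℝ) : Measure ℝ :=
  (volume.restrict (Set.Ioi (0:ℝ))).withDensity (fun t => ENNReal.ofReal (Real.exp (-b * t)))

theorem mmu_le (b : ℝ) (hb : 0 < b) : mmu b ≤ volume := by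
  refine le_trans ?_ (Measure.restrict_le_self (s := Set.Ioi (0:ℝ)))
  conv_rhs => rw [← withDensity_one (μ := volume.restrict (Set.Ioi (0:ℝ)))]
  apply withDensity_mono
  filter_upwards [ae_restrict_mem measurableSet_Ioi] with t ht
  rw [Pi.one_apply, ← ENNReal.ofReal_one]
  apply ENNReal.ofReal_le_ofReal
  rw [Real.exp_le_one_iff]
  have : 0 < t := ht
  nlinarith [mul_pos hb this]

theorem mmu_mass (b : ℝ) (hb : 0 < b) : mmu b Set.univ = ENNReal.ofReal (1 / b) := by
  rw [mmu, withDensity_apply _ MeasurableSet.univ, Measure.restrict_univ,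
    ← ofReal_integral_eq_lintegral_ofReal, integral_exp_mul_Ioi (by linarith)]
  · congr 1; simp
  · exact integrableOn_exp_mul_Ioi (by linarith) 0
  · filter_upwards with t; positivity

instance mmu_fin (b : ℝ) [hb : Fact (0 < b)] : IsFiniteMeasure (mmu b) := by
  constructor
  rw [mmu_mass b hb.out]; exact ENNReal.ofReal_lt_top

/-- the constant -/
noncomputable def CC (α p r : ℝ) : ℝ :=
  (4 ^ (1 - 2/p) * (r * 2⁻¹ ^ α) ^ (-(1/r))) + (6000 ^ ((1 - 2/p)/2) * (r * 2⁻¹ ^ α) ^ ((1 - 2/p)/4 - 1/r))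

theorem block (α p r : ℝ) (hα : 0 < α) (hα2 : α ≤ 2) (hp : 2 < p) (hr : 0 < r)
    (hlow : (1 / α) * (1 - 2 / p) ≤ 1 / r)
    (hhigh : 1 / r < (1 / α + 1 / 4) * (1 - 2 / p)) (κ A l : ℝ) (hκ : 0 < κ) (hA : A ≠ 0) (hl : 0 < l)
    (F : Plane → ℂ) (hF : Measurable F) (M : ℝ) (hM : ∀ x, ‖F x‖ ≤ M)
    (hs : ∀ ξ, F ξ ≠ 0 → ξ ∈ ann l) :
    (∫⁻ t in Set.Ioi (0:ℝ), eLpNorm (UU κ α A F t) (ENNReal.ofReal p) volume ^ r) ^ (1/r) ≤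
      ENNReal.ofReal (CC α p r * κ ^ (-(1 / α) * (1 - 2 / p)) * |A| ^ ((1 / α) * (1 - 2 / p) - 1 / r)) * eLpNorm F 2 volume := by
  have hp0 : 0 < p := by linarith
  set δ := 1 - 2/p with hδ
  have hd : 0 < δ := by rw [hδ, sub_pos, div_lt_one hp0]; exact hp
  have h2p : 2/p = 1 - δ := by rw [hδ]; ring
  have h1d : 0 ≤ 1 - δ := by rw [← h2p]; positivity
  have hA' : 0 < |A| := abs_pos.2 hA
  set N := eLpNorm F 2 volume with hNdef
  have hN : N ≠ ∞ := (supp_good l F hF M hM hs 2).2.ne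
  set b := r * (κ * (l/2)^α) with hb
  have hbp : 0 < b := by positivity
  have : Fact (0 < b) := ⟨hbp⟩
  have mS := SS_meas κ α A l F hF
  have step1 : ∫⁻ t in Set.Ioi (0:ℝ), eLpNorm (UU κ α A F t) (ENNReal.ofReal p) volume ^ r ≤
      N ^ ((1 - δ) * r) * ∫⁻ t, SS κ α A l F t ^ (δ * r) ∂(mmu b) := by
    rw [mmu, lintegral_withDensity_eq_lintegral_mul _ (by fun_prop) (mS.pow_const _),
      ← lintegral_const_mul' _ _ (ENNReal.rpow_ne_top_of_nonneg (by positivity) hN)]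
    apply setLIntegral_mono' measurableSet_Ioi
    intro t ht
    have := UU_p κ α A l p hp hκ hα hl F hF M hM hs t ht
    rw [← hδ, ← hNdef, h2p] at this
    calc _ ≤ (ENNReal.ofReal (Real.exp (-(κ * t * (l/2)^α))) * (SS κ α A l F t ^ δ * N ^ (1 - δ))) ^ r := by gcongr
      _ = ENNReal.ofReal (Real.exp (-(κ * t * (l/2)^α))) ^ r * (SS κ α A l F t ^ (δ * r) * N ^ ((1 - δ) * r)) := by
        rw [ENNReal.mul_rpow_of_nonneg _ _ hr.le, ENNReal.mul_rpow_of_nonneg _ _ hr.le, ENNReal.rpow_mul, ENNReal.rpow_mul]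
      _ = ENNReal.ofReal (Real.exp (-b * t)) * (SS κ α A l F t ^ (δ * r) * N ^ ((1 - δ) * r)) := by
        congr 1
        rw [ENNReal.ofReal_rpow_of_pos (Real.exp_pos _), ← Real.exp_mul]
        congr 2; rw [hb]; ring
      _ = _ := by rw [Pi.mul_apply]; ring
  have fin : ∀ (R : ℝ), 0 ≤ R → ∫⁻ t, SS κ α A l F t ^ (δ * r) ∂(mmu b) ≤ (ENNReal.ofReal R * N ^ δ) ^ r →
      (∫⁻ t in Set.Ioi (0:ℝ), eLpNorm (UU κ α A F t) (ENNReal.ofReal p) volume ^ r) ^ (1/r) ≤ ENNReal.ofReal R * N := by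
    intro R hR h
    calc _ ≤ (N ^ ((1 - δ) * r) * (ENNReal.ofReal R * N ^ δ) ^ r) ^ (1/r) := by
          gcongr
          exact step1.trans (by gcongr)
      _ = N ^ (1 - δ) * (ENNReal.ofReal R * N ^ δ) := by
          rw [ENNReal.rpow_mul, ← ENNReal.mul_rpow_of_nonneg _ _ hr.le, ← ENNReal.rpow_mul, mul_one_div_cancel hr.ne', ENNReal.rpow_one]
      _ = ENNReal.ofReal R * (N ^ (1 - δ) * N ^ δ) := by ring
      _ = _ := by
          rw [← ENNReal.rpow_add_of_nonneg _ _ h1d hd.le, sub_add_cancel, ENNReal.rpow_one]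
  have hCa : 0 ≤ 4 ^ δ * (r * 2⁻¹ ^ α) ^ (-(1/r)) := by positivity
  have hCb : 0 ≤ 6000 ^ (δ/2) * (r * 2⁻¹ ^ α) ^ (δ/4 - 1/r) := by positivity
  rcases le_total |A| (κ * l ^ α) with hc | hc
  · have key := real_a α δ r κ |A| l hα hκ hA' hl hr hlow hc
    rw [← hb] at key
    refine (fin ((4 * l) ^ δ * (1 / b) ^ (1/r)) (by positivity) ?_).trans ?_
    · calc _ ≤ ∫⁻ t, (ENNReal.ofReal (4 * l) * N) ^ (δ * r) ∂(mmu b) := by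
            apply lintegral_mono; intro t
            dsimp only
            gcongr
            exact SS_le κ α A l hκ hl F hF hs t
        _ = (ENNReal.ofReal (4 * l) * N) ^ (δ * r) * ENNReal.ofReal (1/b) := by
            rw [lintegral_const, mmu_mass b hbp]
        _ = ((ENNReal.ofReal (4 * l) * N) ^ δ * ENNReal.ofReal (1/b) ^ (1/r)) ^ r := by
            rw [ENNReal.mul_rpow_of_nonneg _ _ hr.le, ← ENNReal.rpow_mul, ← ENNReal.rpow_mul, one_div_mul_cancel hr.ne', ENNReal.rpow_one]
        _ = _ := by
            rw [ENNReal.mul_rpow_of_nonneg _ _ hd.le, ENNReal.ofReal_rpow_of_pos (by positivity),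
              ENNReal.ofReal_rpow_of_pos (by positivity), ENNReal.ofReal_mul (by positivity)]
            congr 1; ring
    · refine mul_le_mul_left (ENNReal.ofReal_le_ofReal (key.trans ?_)) N
      gcongr
      rw [CC, ← hδ]; linarith
  · have key := real_b α δ r κ |A| l hα hκ hA' hl hr hhigh hc
    rw [← hb] at key
    have h12 : 1/2 * δ ≤ 1/r := by
      refine le_trans ?_ hlow
      gcongr
    have hth : δ * r / 2 ≤ 1 := by
      rw [le_div_iff₀ hr] at h12; linarith
    refine (fin ((6000 * l^2 * |A| ^ (-(1/2) : ℝ) * √(1 / b)) ^ (δ/2) * (1 / b) ^ (1/r - δ/2)) (by positivity) ?_).trans ?_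
    · have hm := max2 hκ α A hA hl F hF M hM (mmu b) (mmu_le b hbp) (1/b) (by positivity) (mmu_mass b hbp).le
      rw [N_eq l F hs, ← hNdef] at hm
      have e2 : 2 * (ENNReal.ofReal (600 * l^2) * ENNReal.ofReal |A| ^ (-(1/2) : ℝ) * ENNReal.ofReal (5 * √(1/b))) = ENNReal.ofReal (6000 * l^2 * |A| ^ (-(1/2) : ℝ) * √(1 / b)) := by
        rw [ENNReal.ofReal_rpow_of_pos hA', ← ENNReal.ofReal_mul (by positivity), ← ENNReal.ofReal_mul (by positivity),
          show (2:ℝ≥0∞) = ENNReal.ofReal 2 by simp, ← ENNReal.ofReal_mul (by positivity)]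
        congr 1; ring
      rw [e2] at hm
      set W := 6000 * l^2 * |A| ^ (-(1/2) : ℝ) * √(1 / b) with hW
      have hWp : 0 < W := by positivity
      calc _ = ∫⁻ t, (SS κ α A l F t ^ 2) ^ (δ * r / 2) * (1:ℝ≥0∞) ^ (1 - δ * r / 2) ∂(mmu b) := by
            congr 1; ext t
            rw [ENNReal.one_rpow, mul_one, ← ENNReal.rpow_natCast, ← ENNReal.rpow_mul]; congr 1; push_cast; ring
        _ ≤ (∫⁻ t, SS κ α A l F t ^ 2 ∂(mmu b)) ^ (δ * r / 2) * (∫⁻ t, (1:ℝ≥0∞) ∂(mmu b)) ^ (1 - δ * r / 2) := by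
            apply ENNReal.lintegral_mul_norm_pow_le (mS.pow_const 2).aemeasurable measurable_const.aemeasurable
              (by positivity) (by linarith) (by ring)
        _ ≤ (ENNReal.ofReal W * N^2) ^ (δ * r / 2) * (ENNReal.ofReal (1/b)) ^ (1 - δ * r / 2) := by
            gcongr
            · rw [lintegral_one, mmu_mass b hbp]
        _ = ((ENNReal.ofReal W * N^2) ^ (δ/2) * ENNReal.ofReal (1/b) ^ (1/r - δ/2)) ^ r := by
            rw [ENNReal.mul_rpow_of_nonneg _ _ hr.le, ← ENNReal.rpow_mul, ← ENNReal.rpow_mul]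
            congr 2
            · ring
            · field_simp
        _ = _ := by
            rw [ENNReal.mul_rpow_of_nonneg (ENNReal.ofReal W) _ (by positivity), ENNReal.ofReal_rpow_of_pos hWp,
              ENNReal.ofReal_rpow_of_pos (by positivity), ENNReal.ofReal_mul (by positivity),
              ← ENNReal.rpow_natCast N 2, ← ENNReal.rpow_mul, show ((2:ℕ):ℝ) * (δ/2) = δ by push_cast; ring]
            congr 1; ring
    · refine mul_le_mul_left (ENNReal.ofReal_le_ofReal (key.trans ?_)) N
      gcongr
      rw [CC, ← hδ]; linarith

theorem lq_mono (q : ℝ≥0∞) (hq : 1 ≤ q) (a b : ℤ → ℝ≥0∞) (c : ℝ≥0∞) (h : ∀ j, a j ≤ c * b j) :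
    lqNorm q a ≤ c * lqNorm q b := by
  unfold lqNorm
  split_ifs with hi
  · rw [ENNReal.mul_iSup]; exact iSup_mono h
  · have hq0 : 0 < q.toReal := ENNReal.toReal_pos (by positivity) hi
    calc _ ≤ (∑' j, (c * b j) ^ q.toReal) ^ (1/q.toReal) := by
          gcongr with j; exact h j
      _ = _ := by
          simp_rw [ENNReal.mul_rpow_of_nonneg _ _ hq0.le]
          rw [ENNReal.tsum_mul_left, ENNReal.mul_rpow_of_nonneg _ _ (by positivity), ← ENNReal.rpow_mul,
            mul_one_div_cancel hq0.ne', ENNReal.rpow_one]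

theorem blk_bdd (P : LP) (j : ℤ) (f : Plane → ℂ) : ∃ M, ∀ ξ, ‖blk P j f ξ‖ ≤ M := by
  have hc : HasCompactSupport (blk P j f) := by
    apply HasCompactSupport.of_support_subset_isCompact (isCompact_closedBall (0:Plane) (2 * 2^j))
    intro ξ h
    simpa using (blk_supp P j f ξ h).2
  exact (blk_cont P j f).bounded_above_of_compact_support hc

end

/-- Strichartz-type estimate for the linear propagator
`T_A(t) = e^{-κt(-Δ)^{α/2}} e^{-At R₁}` in the Chemin–Lerner space:
`‖T_A(·)f‖_{L̃^r(0,∞;Ḃ^s_{p,q})} ≤ C κ^{-(1/α)(1-2/p)} |A|^{(1/α)(1-2/p)-1/r} ‖f‖_{Ḃ^s_{2,q}}`. -/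
theorem strichartz_propagator (P : LP) (α p r : ℝ) (hα0 : 0 < α) (hα2 : α ≤ 2)
    (hlow : (1 / α) * (1 - 2 / p) ≤ 1 / r)
    (hhigh : 1 / r < (1 / α + 1 / 4) * (1 - 2 / p)) :
    ∃ C : ℝ, 0 < C ∧ ∀ (A : ℝ), A ≠ 0 → ∀ (κ : ℝ), 0 < κ →
      ∀ (q : ℝ≥0∞), 1 ≤ q → ∀ (s : ℝ) (f : Plane → ℂ),
        besovNorm P s 2 q f < ∞ →
        cheminLerner P s (ENNReal.ofReal p) q (ENNReal.ofReal r)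
            (fun t => propag κ α A t f) ≤
          ENNReal.ofReal (C * κ ^ (-(1 / α) * (1 - 2 / p)) *
              |A| ^ ((1 / α) * (1 - 2 / p) - 1 / r)) *
            besovNorm P s 2 q f := by
  have hd : 0 < 1 - 2/p := by
    have : 1 / α * (1 - 2/p) < 1 / α * (1 - 2/p) + 1/4 * (1 - 2/p) := by linarith
    linarith
  have hr : 0 < r := by
    have : 0 < 1 / r := lt_of_lt_of_le (by positivity) hlow
    exact one_div_pos.1 this
  have hrt : (ENNReal.ofReal r).toReal = r := ENNReal.toReal_ofReal hr.le
  refine ⟨CC α p r, by unfold CC; positivity, ?_⟩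
  intro A hA κ hκ q hq s f _
  apply lq_mono q hq
  intro j
  rw [← mul_assoc, mul_comm (ENNReal.ofReal (_ * _)), mul_assoc]
  gcongr
  rw [timeLq, if_neg ENNReal.ofReal_ne_top, hrt]
  rcases le_or_gt p 0 with hp | hp
  · have : ENNReal.ofReal p = 0 := ENNReal.ofReal_eq_zero.2 hp
    simp [this, hr]
  have hp2 : 2 < p := by
    rw [sub_pos, div_lt_one hp] at hd; exact hd
  obtain ⟨M, hM⟩ := blk_bdd P j f
  have hs : ∀ ξ, blk P j f ξ ≠ 0 → ξ ∈ ann ((2:ℝ)^j) := fun ξ h => blk_supp P j f ξ h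
  have hF := (blk_cont P j f).measurable
  have g := supp_good _ _ hF M hM hs
  have B := block α p r hα0 hα2 hp2 hr hlow hhigh κ A ((2:ℝ)^j) hκ hA (by positivity) (blk P j f) hF M hM hs
  rw [proj_eq P j f, plancherel_inv _ (memLp_one_iff_integrable.1 (g 1)) (g 2)]
  refine le_trans ?_ B
  gcongr with t
  rcases proj_propag P κ α A t hα0 j f with h | h
  · rw [h]
    have : eLpNorm (fun _ : Plane => (0:ℂ)) (ENNReal.ofReal p) volume = 0 := eLpNorm_zero
    rw [this]; exact zero_le
  · rw [h]; exact le_rfl
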